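/- Let F_q be a finite field of characteristic p, let τ denote the number of positive divisors of p − 1, and let δ denote Kronecker's delta function. Then the number #D_{p²}(F_q) of decomposable monic original polynomials of degree p² over F_q satisfies the equality of rational numbers #D_{p²}(F_q) = q^{2p−2} − q^{p−1} + 1 − (τq − q + 1)(q − 1)(qp − p − 2)/(2(p + 1)) − (1 − δ_{p,2})·q(q − 1)(q − 2)(p − 3)/4. -/

import Mathlib

open Polynomial

/-- The set of decomposable monic original polynomials of degree `n` over `F`:
monic, vanishing at 0, and of the form `g ∘ h` with `deg g, deg h ≥ 2`. -/
def Duniv (F : Type*) [CommRing F] (n : ℕ) : Set (Polynomial F) :=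
  {f | f.Monic ∧ f.natDegree = n ∧ f.eval 0 = 0 ∧
    ∃ g h : Polynomial F, 2 ≤ g.natDegree ∧ 2 ≤ h.natDegree ∧ f = g.comp h}



open Polynomial

set_option linter.unusedSectionVars false
set_option linter.unusedSimpArgs false
set_option linter.deprecated false

structure Coll {K : Type*} [Field K] (p : ℕ) (g₁ h₁ g₂ h₂ : K[X]) : Prop where
  mg₁ : g₁.Monic
  mh₁ : h₁.Monic
  mg₂ : g₂.Monic
  mh₂ : h₂.Monic
  dg₁ : g₁.natDegree = p
  dh₁ : h₁.natDegree = p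
  dg₂ : g₂.natDegree = p
  dh₂ : h₂.natDegree = p
  og₁ : g₁.eval 0 = 0
  oh₁ : h₁.eval 0 = 0
  og₂ : g₂.eval 0 = 0
  oh₂ : h₂.eval 0 = 0
  eq : g₁.comp h₁ = g₂.comp h₂
  ne : h₁ ≠ h₂
  sep : derivative (g₁.comp h₁) ≠ 0

theorem Coll.symm {K : Type*} [Field K] {p : ℕ} {g₁ h₁ g₂ h₂ : K[X]} (H : Coll p g₁ h₁ g₂ h₂) :
    Coll p g₂ h₂ g₁ h₁ :=
  ⟨H.mg₂, H.mh₂, H.mg₁, H.mh₁, H.dg₂, H.dh₂, H.dg₁, H.dh₁, H.og₂, H.oh₂, H.og₁, H.oh₁,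
    H.eq.symm, H.ne.symm, H.eq ▸ H.sep⟩

section
variable {K : Type*} [Field K] {p : ℕ} [Fact p.Prime] [CharP K p]

theorem natCast_ne_zero_of_lt (n : ℕ) (h0 : 0 < n) (hn : n < p) : (n : K) ≠ 0 := by
  rw [Ne, CharP.cast_eq_zero_iff K p]
  exact fun h => absurd (Nat.le_of_dvd h0 h) (by omega)

theorem natDegree_derivative_of_lt (Q : K[X]) (h0 : 0 < Q.natDegree) (hn : Q.natDegree < p) :
    (derivative Q).natDegree = Q.natDegree - 1 := by
  apply natDegree_eq_of_le_of_coeff_ne_zero (natDegree_derivative_le Q)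
  rw [coeff_derivative]
  have h1 : Q.natDegree - 1 + 1 = Q.natDegree := by omega
  rw [h1]
  have h2 : ((Q.natDegree - 1 : ℕ) : K) + 1 = (Q.natDegree : K) := by
    rw [← Nat.cast_succ, Nat.succ_eq_add_one, h1]
  rw [h2]
  refine mul_ne_zero ?_ (natCast_ne_zero_of_lt (p := p) _ h0 hn)
  rw [coeff_natDegree, Ne, leadingCoeff_eq_zero]
  rintro rfl
  simp at h0

theorem derivative_X_pow_p : derivative (X ^ p : K[X]) = 0 := by
  simp [derivative_X_pow, CharP.cast_eq_zero K p]

theorem natDegree_sub_X_pow_lt (P : K[X]) (hm : P.Monic) (hd : P.natDegree = p) :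
    (P - X ^ p).natDegree < p := by
  have hp := (Fact.out : p.Prime).pos
  rcases eq_or_ne (P - X ^ p) 0 with h | h
  · rw [h]; simpa
  rw [natDegree_lt_iff_degree_lt h]
  have := degree_sub_lt (p := P) (q := X ^ p) ?_ hm.ne_zero ?_
  · rwa [degree_eq_natDegree hm.ne_zero, hd] at this
  · rw [degree_eq_natDegree hm.ne_zero, hd, degree_X_pow]
  · simp [hm.leadingCoeff]

theorem natDegree_of_eval_zero (Q : K[X]) (h : Q.eval 0 = 0) (hQ : Q ≠ 0) : 0 < Q.natDegree := by
  by_contra hc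
  have : Q.natDegree = 0 := by omega
  rw [eq_C_of_natDegree_eq_zero this] at h hQ
  simp at h hQ
  exact hQ h

theorem derivative_sub_X_pow (P : K[X]) : derivative (P - X ^ p) = derivative P := by
  rw [derivative_sub, derivative_X_pow_p, sub_zero]

theorem natDegree_sub_X_pow (P : K[X]) (hm : P.Monic) (hd : P.natDegree = p) (ho : P.eval 0 = 0)
    (hs : derivative P ≠ 0) : (P - X ^ p).natDegree = (derivative P).natDegree + 1 := by
  have hp := (Fact.out : p.Prime).pos
  have h1 := natDegree_sub_X_pow_lt P hm hd
  have h2 : 0 < (P - X ^ p).natDegree := by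
    apply natDegree_of_eval_zero
    · simp [ho, hp.ne']
    · intro h
      apply hs
      rw [← derivative_sub_X_pow (p := p), h, derivative_zero]
  have := natDegree_derivative_of_lt (p := p) _ h2 h1
  rw [derivative_sub_X_pow] at this
  omega

theorem natDegree_derivative_le_p (P : K[X]) (hm : P.Monic) (hd : P.natDegree = p) :
    (derivative P).natDegree ≤ p - 2 := by
  have h1 := natDegree_sub_X_pow_lt P hm hd
  have h2 := natDegree_derivative_le (P - X ^ p)
  rw [derivative_sub_X_pow] at h2
  omega

theorem Coll.sep_g₁ {g₁ h₁ g₂ h₂ : K[X]} (H : Coll p g₁ h₁ g₂ h₂) : derivative g₁ ≠ 0 := by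
  intro h
  apply H.sep
  rw [derivative_comp, h, zero_comp, mul_zero]

theorem Coll.sep_h₁ {g₁ h₁ g₂ h₂ : K[X]} (H : Coll p g₁ h₁ g₂ h₂) : derivative h₁ ≠ 0 := by
  intro h
  apply H.sep
  rw [derivative_comp, h, zero_mul]

theorem Coll.natDegree_f' {g₁ h₁ g₂ h₂ : K[X]} (H : Coll p g₁ h₁ g₂ h₂) :
    (derivative (g₁.comp h₁)).natDegree = (derivative h₁).natDegree +
      p * (derivative g₁).natDegree := by
  have h2 : (derivative g₁).comp h₁ ≠ 0 := by
    intro h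
    apply H.sep
    rw [derivative_comp, h, mul_zero]
  rw [derivative_comp, natDegree_mul H.sep_h₁ h2, natDegree_comp, H.dh₁, mul_comm p]

theorem Coll.natDegree_eq {g₁ h₁ g₂ h₂ : K[X]} (H : Coll p g₁ h₁ g₂ h₂) :
    (derivative g₁).natDegree = (derivative g₂).natDegree ∧
    (derivative h₁).natDegree = (derivative h₂).natDegree := by
  have h1 := H.natDegree_f'
  have h2 := H.symm.natDegree_f'
  rw [← H.eq, h1] at h2
  have hp := (Fact.out : p.Prime).two_le
  have a1 := natDegree_derivative_le_p h₁ H.mh₁ H.dh₁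
  have a2 := natDegree_derivative_le_p h₂ H.mh₂ H.dh₂
  have e1 := congrArg (· % p) h2
  have e2 := congrArg (· / p) h2
  simp only [Nat.add_mul_mod_self_left] at e1
  rw [Nat.mod_eq_of_lt (by omega), Nat.mod_eq_of_lt (by omega)] at e1
  simp only [Nat.add_mul_div_left _ _ (by omega : 0 < p)] at e2
  rw [Nat.div_eq_of_lt (by omega), Nat.div_eq_of_lt (by omega)] at e2
  omega

/-- degree of a difference of compositions -/
theorem natDegree_comp_sub_comp (u a b : K[X]) (ha : a.Monic) (hb : b.Monic)
    (hda : a.natDegree = p) (hdb : b.natDegree = p) (hab : a ≠ b) (h0 : 0 < u.natDegree)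
    (hu : u.natDegree < p) :
    (u.comp a - u.comp b).natDegree = p * (u.natDegree - 1) + (a - b).natDegree := by
  set E : K[X] := ∑ n ∈ Finset.range (u.natDegree + 1), C (u.coeff n) *
    ∑ i ∈ Finset.range n, a ^ i * b ^ (n - 1 - i) with hE
  have h1 : u.comp a - u.comp b = E * (a - b) := by
    rw [comp_eq_sum_left, comp_eq_sum_left, sum_over_range _ (by simp), sum_over_range _ (by simp),
      ← Finset.sum_sub_distrib, hE, Finset.sum_mul]
    apply Finset.sum_congr rfl
    intro n _
    rw [mul_assoc, (Commute.all a b).geom_sum₂_mul n]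
    ring
  have hdeg : ∀ n i, i < n → (a ^ i * b ^ (n - 1 - i)).natDegree = p * (n - 1) := by
    intro n i hi
    rw [(ha.pow i).natDegree_mul (hb.pow _), ha.natDegree_pow, hb.natDegree_pow, hda, hdb,
      mul_comm _ p, mul_comm _ p, ← mul_add]
    congr 1; omega
  have hmon : ∀ n i, (a ^ i * b ^ (n - 1 - i)).Monic := fun n i => (ha.pow i).mul (hb.pow _)
  have hp := (Fact.out : p.Prime).pos
  have hEd : E.natDegree = p * (u.natDegree - 1) := by
    apply natDegree_eq_of_le_of_coeff_ne_zero
    · apply natDegree_sum_le_of_forall_le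
      intro n hn
      refine (natDegree_C_mul_le _ _).trans ?_
      apply natDegree_sum_le_of_forall_le
      intro i hi
      rw [hdeg n i (Finset.mem_range.1 hi)]
      have := Finset.mem_range.1 hn
      exact Nat.mul_le_mul_left _ (by omega)
    · rw [hE, finset_sum_coeff, Finset.sum_range_succ, Finset.sum_eq_zero, zero_add, coeff_C_mul,
        finset_sum_coeff]
      · rw [Finset.sum_congr rfl (g := fun _ => (1 : K))]
        · simp only [Finset.sum_const, Finset.card_range, nsmul_eq_mul, mul_one]
          refine mul_ne_zero ?_ (natCast_ne_zero_of_lt (p := p) _ h0 hu)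
          rw [coeff_natDegree, Ne, leadingCoeff_eq_zero]
          rintro rfl
          simp at h0
        · intro i hi
          rw [← hdeg _ i (Finset.mem_range.1 hi)]
          exact (hmon _ i).coeff_natDegree
      · intro n hn
        rw [coeff_C_mul, finset_sum_coeff, Finset.sum_eq_zero, mul_zero]
        intro i hi
        apply coeff_eq_zero_of_natDegree_lt
        rw [hdeg n i (Finset.mem_range.1 hi)]
        have := Finset.mem_range.1 hn
        have := Finset.mem_range.1 hi
        exact Nat.mul_lt_mul_of_pos_left (by omega) hp
  have hE0 : E ≠ 0 := by
    intro h
    have h2 := sub_ne_zero.2 hab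
    rw [h, zero_mul] at h1
    have h3 : u.comp a = u.comp b := sub_eq_zero.1 h1
    -- if E = 0 then its top coefficient vanishes
    have h4 : E.coeff (p * (u.natDegree - 1)) ≠ 0 := by
      rw [hE, finset_sum_coeff, Finset.sum_range_succ, Finset.sum_eq_zero, zero_add, coeff_C_mul,
        finset_sum_coeff]
      · rw [Finset.sum_congr rfl (g := fun _ => (1 : K))]
        · simp only [Finset.sum_const, Finset.card_range, nsmul_eq_mul, mul_one]
          refine mul_ne_zero ?_ (natCast_ne_zero_of_lt (p := p) _ h0 hu)
          rw [coeff_natDegree, Ne, leadingCoeff_eq_zero]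
          rintro rfl
          simp at h0
        · intro i hi
          rw [← hdeg _ i (Finset.mem_range.1 hi)]
          exact (hmon _ i).coeff_natDegree
      · intro n hn
        rw [coeff_C_mul, finset_sum_coeff, Finset.sum_eq_zero, mul_zero]
        intro i hi
        apply coeff_eq_zero_of_natDegree_lt
        rw [hdeg n i (Finset.mem_range.1 hi)]
        have := Finset.mem_range.1 hn
        have := Finset.mem_range.1 hi
        exact Nat.mul_lt_mul_of_pos_left (by omega) hp
    rw [h] at h4
    simp at h4
  rw [h1, natDegree_mul hE0 (sub_ne_zero.2 hab), hEd]

theorem Coll.D_pos {g₁ h₁ g₂ h₂ : K[X]} (H : Coll p g₁ h₁ g₂ h₂) : 0 < (h₁ - h₂).natDegree :=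
  natDegree_of_eval_zero _ (by simp [H.oh₁, H.oh₂]) (sub_ne_zero.2 H.ne)

theorem Coll.D_lt {g₁ h₁ g₂ h₂ : K[X]} (H : Coll p g₁ h₁ g₂ h₂) : (h₁ - h₂).natDegree < p := by
  have e : h₁ - h₂ = (h₁ - X ^ p) - (h₂ - X ^ p) := by ring
  rw [e]
  refine (natDegree_sub_le _ _).trans_lt (max_lt ?_ ?_)
  · exact natDegree_sub_X_pow_lt _ H.mh₁ H.dh₁
  · exact natDegree_sub_X_pow_lt _ H.mh₂ H.dh₂

theorem leadingCoeff_f' {g h : K[X]} (hm : h.Monic) (hd : h.natDegree = p) :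
    (derivative (g.comp h)).leadingCoeff = (derivative h).leadingCoeff *
      (derivative g).leadingCoeff := by
  rw [derivative_comp, leadingCoeff_mul, leadingCoeff_comp, hm.leadingCoeff, one_pow, mul_one]
  rw [hd]; exact (Fact.out : p.Prime).ne_zero

/-- leading coefficient of the derivative in terms of the sub-leading part -/
theorem coeff_sub_X_pow (P : K[X]) (hm : P.Monic) (hd : P.natDegree = p) (ho : P.eval 0 = 0)
    (hs : derivative P ≠ 0) :
    (derivative P).leadingCoeff = (P - X ^ p).coeff ((derivative P).natDegree + 1) *
      (((derivative P).natDegree + 1 : ℕ) : K) := by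
  have h : (derivative P).leadingCoeff =
      (derivative (P - X ^ p)).coeff (derivative P).natDegree := by
    rw [derivative_sub_X_pow]; rfl
  rw [h, coeff_derivative]
  push_cast
  rfl

theorem Coll.natDegree_D {g₁ h₁ g₂ h₂ : K[X]} (H : Coll p g₁ h₁ g₂ h₂) :
    (derivative h₁).natDegree = (derivative g₁).natDegree := by
  have hp := (Fact.out : p.Prime).pos
  have hD0 := H.D_pos
  have hDp := H.D_lt
  obtain ⟨eg, eh⟩ := H.natDegree_eq
  set u := g₁ - X ^ p with hu
  set v := g₂ - X ^ p with hv
  set κ := (derivative g₁).natDegree with hκ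
  have du : u.natDegree = κ + 1 := natDegree_sub_X_pow g₁ H.mg₁ H.dg₁ H.og₁ H.sep_g₁
  have dv : v.natDegree = κ + 1 := by
    rw [eg]; exact natDegree_sub_X_pow g₂ H.mg₂ H.dg₂ H.og₂ H.symm.sep_g₁
  have hκp : κ + 1 < p := by
    rw [← du]; exact natDegree_sub_X_pow_lt g₁ H.mg₁ H.dg₁
  have key : (h₁ - h₂) ^ p = (v - u).comp h₂ - (u.comp h₁ - u.comp h₂) := by
    have e1 : g₁ = X ^ p + u := by rw [hu]; ring
    have e2 : g₂ = X ^ p + v := by rw [hv]; ring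
    have := H.eq
    rw [e1, e2] at this
    simp only [add_comp, X_pow_comp] at this
    rw [sub_pow_char (R := K[X]) (p := p)]
    rw [sub_comp]
    linear_combination this
  have hsub := natDegree_comp_sub_comp (p := p) u h₁ h₂ H.mh₁ H.mh₂ H.dh₁ H.dh₂ H.ne (by omega)
    (by omega)
  rw [du, Nat.add_sub_cancel] at hsub
  have d1 : ((h₁ - h₂) ^ p).natDegree = p * (h₁ - h₂).natDegree := natDegree_pow _ _
  have d2 : ((v - u).comp h₂).natDegree = p * (v - u).natDegree := by
    rw [natDegree_comp, H.dh₂, mul_comm]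
  have hvu : (v - u).natDegree ≤ κ + 1 := by
    refine (natDegree_sub_le _ _).trans ?_
    rw [du, dv, max_self]
  set δ := (h₁ - h₂).natDegree with hδ
  set k := (v - u).natDegree with hk
  have hne : p * k ≠ p * κ + δ := by
    intro h
    have := congrArg (· % p) h
    simp only [Nat.mul_mod_right, Nat.mul_add_mod] at this
    rw [Nat.mod_eq_of_lt hDp] at this
    omega
  have hlt : p * κ + δ < p * k := by
    rcases lt_or_gt_of_ne hne with h | h
    · exfalso
      have : ((v - u).comp h₂ - (u.comp h₁ - u.comp h₂)).natDegree = p * κ + δ := by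
        rw [natDegree_sub_eq_right_of_natDegree_lt, hsub]
        rw [d2, hsub]; exact h
      rw [← key, d1] at this
      have := congrArg (· % p) this
      simp only [Nat.mul_mod_right, Nat.mul_add_mod] at this
      rw [Nat.mod_eq_of_lt hDp] at this
      omega
    · exact h
  have hkk : k = κ + 1 := by
    have : κ < k := by
      by_contra hc
      have : p * k ≤ p * κ := Nat.mul_le_mul_left _ (by omega)
      omega
    omega
  have hδk : δ = k := by
    have : ((v - u).comp h₂ - (u.comp h₁ - u.comp h₂)).natDegree = p * k := by
      rw [natDegree_sub_eq_left_of_natDegree_lt, d2]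
      rw [d2, hsub]; exact hlt
    rw [← key, d1] at this
    exact Nat.eq_of_mul_eq_mul_left hp this
  -- leading coefficients of g₁', g₂' differ
  have hκ1 : ((κ + 1 : ℕ) : K) ≠ 0 := natCast_ne_zero_of_lt (p := p) _ (by omega) hκp
  have lg : (derivative g₁).leadingCoeff ≠ (derivative g₂).leadingCoeff := by
    rw [coeff_sub_X_pow g₁ H.mg₁ H.dg₁ H.og₁ H.sep_g₁,
      coeff_sub_X_pow g₂ H.mg₂ H.dg₂ H.og₂ H.symm.sep_g₁, ← eg]
    intro h
    have h := mul_right_cancel₀ hκ1 h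
    have h2 : (v - u).coeff k = 0 := by
      rw [coeff_sub, hkk, sub_eq_zero]; exact h.symm
    rw [hk, coeff_natDegree, leadingCoeff_eq_zero] at h2
    rw [h2, natDegree_zero] at hk
    omega
  have hprod : (derivative h₁).leadingCoeff * (derivative g₁).leadingCoeff =
      (derivative h₂).leadingCoeff * (derivative g₂).leadingCoeff := by
    rw [← leadingCoeff_f' (p := p) H.mh₁ H.dh₁, ← leadingCoeff_f' (p := p) H.mh₂ H.dh₂, H.eq]
  set κ' := (derivative h₁).natDegree with hκ'
  have d1' : (h₁ - X ^ p).natDegree = κ' + 1 :=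
    natDegree_sub_X_pow h₁ H.mh₁ H.dh₁ H.oh₁ H.sep_h₁
  have d2' : (h₂ - X ^ p).natDegree = κ' + 1 := by
    rw [eh]
    exact natDegree_sub_X_pow h₂ H.mh₂ H.dh₂ H.oh₂ H.symm.sep_h₁
  have hle : δ ≤ κ' + 1 := by
    have e : h₁ - h₂ = (h₁ - X ^ p) - (h₂ - X ^ p) := by ring
    rw [hδ, e]
    refine (natDegree_sub_le _ _).trans ?_
    rw [d1', d2', max_self]
  have hge : κ' + 1 ≤ δ := by
    apply le_natDegree_of_ne_zero
    intro h
    have e : h₁ - h₂ = (h₁ - X ^ p) - (h₂ - X ^ p) := by ring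
    rw [e, coeff_sub, sub_eq_zero] at h
    have : (derivative h₁).leadingCoeff = (derivative h₂).leadingCoeff := by
      rw [coeff_sub_X_pow h₁ H.mh₁ H.dh₁ H.oh₁ H.sep_h₁,
        coeff_sub_X_pow h₂ H.mh₂ H.dh₂ H.oh₂ H.symm.sep_h₁, ← eh, h]
    rw [← this] at hprod
    exact lg (mul_left_cancel₀ (leadingCoeff_ne_zero.2 H.sep_h₁) hprod)
  omega

end


open Polynomial

set_option linter.unusedSectionVars false
set_option linter.unusedSimpArgs false
set_option linter.deprecated false
set_option linter.unusedVariables false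

section
variable {K : Type*} [Field K] {p : ℕ} [Fact p.Prime]

theorem sum_comp_mul_pow_eq_zero (h D : K[X]) (hd : h.natDegree = p)
    (hD0 : 0 < D.natDegree) (hDp : D.natDegree < p) (n : ℕ → K[X])
    (hs : ∑ i ∈ Finset.range p, (n i).comp h * D ^ i = 0) : ∀ i < p, n i = 0 := by
  have hpp := (Fact.out : p.Prime)
  have hDne : D ≠ 0 := by rintro rfl; simp at hD0
  have hdeg : ∀ i, n i ≠ 0 → ((n i).comp h * D ^ i).degree =
      ((p * (n i).natDegree + i * D.natDegree : ℕ) : WithBot ℕ) := by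
    intro i hi
    have h1 : (n i).comp h ≠ 0 := by
      rw [Ne, comp_eq_zero_iff]
      rintro (h1 | ⟨_, h1⟩)
      · exact hi h1
      · rw [h1, natDegree_C] at hd; exact hpp.ne_zero hd.symm
    rw [degree_eq_natDegree (mul_ne_zero h1 (pow_ne_zero _ hDne)),
      natDegree_mul h1 (pow_ne_zero _ hDne), natDegree_comp, natDegree_pow, hd, mul_comm p]
  have := degree_sum_eq_of_disjoint (fun i => (n i).comp h * D ^ i) (Finset.range p) ?_
  · rw [hs, degree_zero] at this
    intro i hi
    by_contra hne
    have h2 := Finset.le_sup (f := fun i => ((n i).comp h * D ^ i).degree) (Finset.mem_range.2 hi)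
    rw [← this, hdeg i hne] at h2
    exact WithBot.coe_ne_bot (le_bot_iff.1 h2)
  · rintro i ⟨hi, hi0⟩ j ⟨hj, hj0⟩ hij
    have hi := Finset.mem_range.1 hi
    have hj := Finset.mem_range.1 hj
    have hni : n i ≠ 0 := by rintro h; simp [h] at hi0
    have hnj : n j ≠ 0 := by rintro h; simp [h] at hj0
    simp only [Function.comp, Ne, Function.onFun]
    rw [hdeg i hni, hdeg j hnj]
    intro he
    have he : p * (n i).natDegree + i * D.natDegree = p * (n j).natDegree + j * D.natDegree := by
      exact_mod_cast he
    have hm : i * D.natDegree ≡ j * D.natDegree [MOD p] := by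
      have := congrArg (· % p) he
      simpa [Nat.ModEq, Nat.mul_add_mod] using this
    have hcop : Nat.gcd p D.natDegree = 1 := by
      rw [← Nat.coprime_iff_gcd_eq_one, hpp.coprime_iff_not_dvd]
      exact fun h => absurd (Nat.le_of_dvd hD0 h) (by omega)
    have := Nat.ModEq.cancel_right_of_coprime hcop hm
    rw [Nat.ModEq, Nat.mod_eq_of_lt hi, Nat.mod_eq_of_lt hj] at this
    exact hij this

theorem exists_relation (h D : K[X]) (hd : h.natDegree = p)
    (hD0 : 0 < D.natDegree) (hDp : D.natDegree < p) :
    ∃ (d : K[X]) (n : ℕ → K[X]), d ≠ 0 ∧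
      d.comp h * X = ∑ i ∈ Finset.range p, (n i).comp h * D ^ i := by
  have hpp := (Fact.out : p.Prime)
  by_contra hcon
  push Not at hcon
  set N := p * p + 3 with hN
  set M := p * N + p * p + 2 with hM
  let c : Fin (p + 1) → K[X] := fun i => if (i : ℕ) < p then D ^ (i : ℕ) else X
  let φ : (Fin (p + 1) → degreeLT K N) →ₗ[K] K[X] :=
    ∑ i, (LinearMap.mulRight K (c i)) ∘ₗ (aeval h : K[X] →ₐ[K] K[X]).toLinearMap ∘ₗ
      (degreeLT K N).subtype ∘ₗ LinearMap.proj i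
  have hφ : ∀ v, φ v = ∑ i, ((v i : K[X])).comp h * c i := by
    intro v
    simp only [φ, LinearMap.sum_apply, LinearMap.comp_apply, LinearMap.mulRight_apply,
      AlgHom.toLinearMap_apply, Submodule.subtype_apply, LinearMap.proj_apply]
    rfl
  have hφ2 : ∀ v, φ v = ∑ i ∈ Finset.range p,
      ((if hi : i < p + 1 then (v ⟨i, hi⟩ : K[X]) else 0)).comp h * D ^ i +
      (v (Fin.last p) : K[X]).comp h * X := by
    intro v
    rw [hφ, Fin.sum_univ_castSucc, Finset.sum_range]
    congr 1
    · apply Finset.sum_congr rfl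
      intro i _
      have : (i : ℕ) < p + 1 := by omega
      simp only [c, Fin.val_castSucc, i.2, if_true, this, dif_pos]
      rfl
    · simp [c]
  have hinj : Function.Injective φ := by
    rw [← LinearMap.ker_eq_bot, LinearMap.ker_eq_bot']
    intro v hv
    have hv0 := hv
    rw [hφ2] at hv
    have hlast : (v (Fin.last p) : K[X]) = 0 := by
      by_contra hne
      refine hcon (v (Fin.last p) : K[X])
        (fun i => - (if hi : i < p + 1 then (v ⟨i, hi⟩ : K[X]) else 0)) hne ?_
      simp only [neg_comp, neg_mul, Finset.sum_neg_distrib]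
      linear_combination hv
    rw [hlast, zero_comp, zero_mul, add_zero] at hv
    have := sum_comp_mul_pow_eq_zero h D hd hD0 hDp _ hv
    funext i
    refine Fin.lastCases ?_ (fun i => ?_) i
    · exact Subtype.ext hlast
    · have h1 := this i i.2
      have h2 : (i : ℕ) < p + 1 := by omega
      rw [dif_pos h2] at h1
      exact Subtype.ext h1
  have hrange : LinearMap.range φ ≤ degreeLT K M := by
    rintro _ ⟨v, rfl⟩
    rw [hφ]
    refine Submodule.sum_mem _ fun i _ => ?_
    rw [mem_degreeLT]
    refine (degree_le_natDegree).trans_lt ?_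
    refine Nat.cast_lt.2 ?_
    refine natDegree_mul_le.trans_lt ?_
    have h1 : ((v i : K[X]).comp h).natDegree ≤ p * N := by
      rw [natDegree_comp, hd, mul_comm]
      refine Nat.mul_le_mul_left _ ?_
      by_cases h0 : (v i : K[X]) = 0
      · rw [h0]; simp
      · exact ((natDegree_lt_iff_degree_lt h0).2 (mem_degreeLT.1 (v i).2)).le
    have h2 : (c i).natDegree ≤ p * p + 1 := by
      simp only [c]
      split_ifs with hi
      · rw [natDegree_pow]
        have := Nat.mul_le_mul hi.le hDp.le
        omega
      · rw [natDegree_X]; omega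
    omega
  have f1 : ∀ n, Module.finrank K (degreeLT K n) = n := by
    intro n
    rw [(degreeLTEquiv K n).finrank_eq]; simp
  have : ∀ n, Module.Finite K (degreeLT K n) := fun n =>
    Module.Finite.equiv (degreeLTEquiv K n).symm
  have f2 := LinearMap.finrank_range_of_inj hinj
  have f3 := Submodule.finrank_mono hrange
  rw [f2, f1, Module.finrank_pi_fintype] at f3
  simp only [f1, Finset.sum_const, Finset.card_univ, Fintype.card_fin, smul_eq_mul] at f3
  have : (p + 1) * N = p * N + N := by ring
  omega

end

section
variable {K : Type*} [Field K] [IsAlgClosed K] {p : ℕ} [Fact p.Prime] [CharP K p]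

theorem eq_prod_roots' (P : K[X]) (hm : P.Monic) : P = (P.roots.map fun x => X - C x).prod :=
  (IsAlgClosed.splits P).eq_prod_roots_of_monic hm

theorem monic_sub_C' (P : K[X]) (hm : P.Monic) (hd : P.natDegree = p) (c : K) :
    (P - C c).Monic := by
  apply hm.sub_of_left
  refine degree_C_le.trans_lt ?_
  rw [degree_eq_natDegree hm.ne_zero, hd]
  exact_mod_cast (Fact.out : p.Prime).pos

theorem natDegree_sub_C' (P : K[X]) (hd : P.natDegree = p) (c : K) :
    (P - C c).natDegree = p := by rw [natDegree_sub_C, hd]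

theorem card_roots_sub (P : K[X]) (hd : P.natDegree = p) (c : K) :
    Multiset.card (P - C c).roots = p := by
  rw [← (IsAlgClosed.splits (P - C c)).natDegree_eq_card_roots, natDegree_sub_C, hd]

theorem prod_swap (h₁ h₂ : K[X]) (mh₁ : h₁.Monic) (mh₂ : h₂.Monic) (dh₁ : h₁.natDegree = p)
    (dh₂ : h₂.natDegree = p) (y z : K) :
    ((h₂ - C z).roots.map fun x => y - h₁.eval x).prod =
    ((h₁ - C y).roots.map fun t => h₂.eval t - z).prod := by
  have e1 : ∀ x, y - h₁.eval x = ((h₁ - C y).roots.map fun t => t - x).prod := by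
    intro x
    have h := congrArg (eval x) (eq_prod_roots' _ (monic_sub_C' h₁ mh₁ dh₁ y))
    rw [eval_sub, eval_C, eval_multiset_prod, Multiset.map_map] at h
    simp only [Function.comp_def, eval_sub, eval_X, eval_C] at h
    have : ((h₁ - C y).roots.map fun t => x - t) = ((h₁ - C y).roots.map fun t => (-1) * (t - x)) := by
      apply Multiset.map_congr rfl; intros; ring
    rw [this, Multiset.prod_map_mul, Multiset.map_const', Multiset.prod_replicate,
      card_roots_sub h₁ dh₁, neg_one_pow_char (R := K) (p := p)] at h
    linear_combination -h
  have e2 : ∀ t, h₂.eval t - z = ((h₂ - C z).roots.map fun x => t - x).prod := by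
    intro x
    have h := congrArg (eval x) (eq_prod_roots' _ (monic_sub_C' h₂ mh₂ dh₂ z))
    rw [eval_sub, eval_C, eval_multiset_prod, Multiset.map_map] at h
    simpa only [Function.comp_def, eval_sub, eval_X, eval_C] using h
  simp only [e1, e2]
  exact Multiset.prod_map_prod_map _ _

theorem Coll.roots_eq {g₁ h₁ g₂ h₂ : K[X]} (H : Coll p g₁ h₁ g₂ h₂) (z : K) :
    (g₁ - C (g₂.eval z)).roots = (h₂ - C z).roots.map (fun x => h₁.eval x) := by
  classical
  obtain ⟨d, n, hd0, hrel⟩ := exists_relation h₂ (h₁ - h₂) H.dh₂ H.D_pos H.D_lt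
  -- bad values
  set B : Finset K := d.roots.toFinset ∪ (derivative h₂).roots.toFinset.image (fun x => h₂.eval x)
    with hB
  have hgood : ∀ z ∉ B, (g₁ - C (g₂.eval z)).roots = (h₂ - C z).roots.map (fun x => h₁.eval x) := by
    intro z hz
    rw [hB, Finset.mem_union, not_or] at hz
    obtain ⟨hz1, hz2⟩ := hz
    have hdz : d.eval z ≠ 0 := by
      intro h; apply hz1; rw [Multiset.mem_toFinset, mem_roots hd0]; exact h
    have hroot : ∀ x ∈ (h₂ - C z).roots, h₂.eval x = z := by
      intro x hx
      have := (mem_roots'.1 hx).2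
      rw [IsRoot, eval_sub, eval_C, sub_eq_zero] at this
      exact this
    have hnd : (h₂ - C z).roots.Nodup := by
      rw [Multiset.nodup_iff_count_le_one]
      intro x
      rw [count_roots]
      by_contra hc
      push Not at hc
      have hne := (monic_sub_C' h₂ H.mh₂ H.dh₂ z).ne_zero
      have := (one_lt_rootMultiplicity_iff_isRoot hne).1 hc
      apply hz2
      rw [Finset.mem_image]
      refine ⟨x, ?_, hroot x ((mem_roots hne).2 this.1)⟩
      rw [Multiset.mem_toFinset, mem_roots H.symm.sep_h₁]
      simpa using this.2
    have hnd2 : ((h₂ - C z).roots.map (fun x => h₁.eval x)).Nodup := by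
      apply Multiset.Nodup.map_on _ hnd
      intro x hx t ht hxt
      have hx := hroot x hx
      have ht := hroot t ht
      have e1 := congrArg (eval x) hrel
      have e2 := congrArg (eval t) hrel
      simp only [eval_mul, eval_comp, eval_X, eval_finset_sum, eval_pow, eval_sub, hx, ht] at e1 e2
      rw [← hxt, ← e1] at e2
      exact (mul_left_cancel₀ hdz e2).symm
    symm
    apply Multiset.eq_of_le_of_card_le
    · rw [Multiset.le_iff_subset hnd2]
      intro y hy
      obtain ⟨x, hx, rfl⟩ := Multiset.mem_map.1 hy
      rw [mem_roots (monic_sub_C' g₁ H.mg₁ H.dg₁ _).ne_zero, IsRoot, eval_sub, eval_C, sub_eq_zero,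
        ← eval_comp, H.eq, eval_comp, hroot x hx]
    · rw [Multiset.card_map, card_roots_sub g₁ H.dg₁, card_roots_sub h₂ H.dh₂]
  have hval : ∀ y z, ((h₂ - C z).roots.map fun x => y - h₁.eval x).prod = g₁.eval y - g₂.eval z := by
    intro y
    have hpoly : ((h₁ - C y).roots.map fun t => C (h₂.eval t) - X).prod = C (g₁.eval y) - g₂ := by
      apply eq_of_infinite_eval_eq
      apply (Finset.finite_toSet B).infinite_compl.mono
      intro z hz
      have hz := hgood z hz
      rw [Set.mem_setOf_eq, eval_multiset_prod, Multiset.map_map]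
      simp only [Function.comp_def, eval_sub, eval_X, eval_C]
      rw [← prod_swap h₁ h₂ H.mh₁ H.mh₂ H.dh₁ H.dh₂]
      have h3 := congrArg (eval y) (eq_prod_roots' _ (monic_sub_C' g₁ H.mg₁ H.dg₁ (g₂.eval z)))
      rw [hz, eval_sub, eval_C, eval_multiset_prod, Multiset.map_map, Multiset.map_map] at h3
      simp only [Function.comp_def, eval_sub, eval_X, eval_C] at h3
      exact h3.symm
    intro z
    rw [prod_swap h₁ h₂ H.mh₁ H.mh₂ H.dh₁ H.dh₂]
    have := congrArg (eval z) hpoly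
    rw [eval_multiset_prod, Multiset.map_map] at this
    simpa only [Function.comp_def, eval_sub, eval_X, eval_C] using this
  have hfin : g₁ - C (g₂.eval z) = (((h₂ - C z).roots.map (fun x => h₁.eval x)).map
      fun y => X - C y).prod := by
    apply Polynomial.funext
    intro y
    rw [eval_multiset_prod, Multiset.map_map, Multiset.map_map]
    simp only [Function.comp_def, eval_sub, eval_X, eval_C]
    exact (hval y z).symm
  rw [hfin, roots_multiset_prod_X_sub_C]

end


open Polynomial

set_option linter.unusedSectionVars false
set_option linter.unusedSimpArgs false
set_option linter.deprecated false
set_option linter.unusedVariables false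

theorem comb_aux {α β : Type*} [DecidableEq β] (X : Finset α) (Y : Finset β) (f : α → β)
    (E E' : α → ℕ) (ε : β → ℕ) (p t : ℕ) (hp : p.Prime) (ht1 : 1 < t) (htp : t < p)
    (hf : ∀ x ∈ X, f x ∈ Y) (hE : ∀ x ∈ X, 0 < E x) (hε : ∀ y ∈ Y, 0 < ε y)
    (hsum : ∑ y ∈ Y, ε y = p) (hmul : ∀ x ∈ X, ε (f x) * E x = t * E' x)
    (hfib : ∀ y ∈ Y, ∑ x ∈ X with f x = y, E' x = ε y) :
    t - 1 ≤ ∑ x ∈ X, (E x - 1) ∧ (∑ x ∈ X, (E x - 1) = t - 1 →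
      ∃ y₀ ∈ Y, Nat.Coprime t (ε y₀) ∧ (∃ x ∈ X, f x = y₀ ∧ E x = t ∧ E' x = ε y₀) ∧
        ∀ y ∈ Y, y ≠ y₀ → t ∣ ε y) := by
  have hEs : ∀ y ∈ Y, ∑ x ∈ X with f x = y, E x = t := by
    intro y hy
    apply Nat.eq_of_mul_eq_mul_left (hε y hy)
    rw [Finset.mul_sum, ← hfib y hy, mul_comm _ t, Finset.mul_sum, hfib y hy]
    apply Finset.sum_congr rfl
    intro x hx
    rw [Finset.mem_filter] at hx
    rw [← hx.2, hmul x hx.1]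
  have hs : ∀ y ∈ Y, ∑ x ∈ X with f x = y, (E x - 1) + (X.filter (f · = y)).card = t := by
    intro y hy
    rw [Finset.card_eq_sum_ones, ← Finset.sum_add_distrib, ← hEs y hy]
    apply Finset.sum_congr rfl
    intro x hx
    have := hE x (Finset.mem_filter.1 hx).1
    omega
  have hcard : ∀ y ∈ Y, (X.filter (f · = y)).card ≤ Nat.gcd t (ε y) := by
    intro y hy
    have h1 : ∀ x ∈ X.filter (f · = y), t ≤ Nat.gcd t (ε y) * E x := by
      intro x hx
      rw [Finset.mem_filter] at hx
      apply Nat.le_of_dvd (Nat.mul_pos (Nat.gcd_pos_of_pos_left _ (by omega)) (hE x hx.1))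
      rw [← Nat.gcd_mul_right]
      apply Nat.dvd_gcd (dvd_mul_right _ _)
      rw [← hx.2, hmul x hx.1]
      exact dvd_mul_right _ _
    have h2 := Finset.sum_le_sum h1
    rw [← Finset.mul_sum, hEs y hy, Finset.sum_const, smul_eq_mul] at h2
    exact Nat.le_of_mul_le_mul_right h2 (by omega)
  have htot : ∑ x ∈ X, (E x - 1) = ∑ y ∈ Y, ∑ x ∈ X with f x = y, (E x - 1) :=
    (Finset.sum_fiberwise_of_maps_to hf _).symm
  obtain ⟨y₀, hy₀, hnd⟩ : ∃ y₀ ∈ Y, ¬ t ∣ ε y₀ := by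
    by_contra hc
    push Not at hc
    have : t ∣ p := hsum ▸ Finset.dvd_sum hc
    rcases (Nat.dvd_prime hp).1 this with h | h <;> omega
  have hhalf : ∀ y, ¬ t ∣ ε y → 2 * Nat.gcd t (ε y) ≤ t := by
    intro y hy
    obtain ⟨k, hk⟩ := Nat.gcd_dvd_left t (ε y)
    have hk1 : k ≠ 1 := by
      rintro rfl
      apply hy
      rw [hk, mul_one]
      have := Nat.gcd_dvd_right t (ε y)
      exact this
    have hk0 : k ≠ 0 := by rintro rfl; omega
    calc 2 * Nat.gcd t (ε y) = Nat.gcd t (ε y) * 2 := mul_comm _ _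
      _ ≤ Nat.gcd t (ε y) * k := Nat.mul_le_mul_left _ (by omega)
      _ = t := hk.symm
  by_cases hex : ∃ y₁ ∈ Y, y₁ ≠ y₀ ∧ ¬ t ∣ ε y₁
  · obtain ⟨y₁, hy₁, hne, hnd₁⟩ := hex
    have h2 : ∑ y ∈ ({y₀, y₁} : Finset β), ∑ x ∈ X with f x = y, (E x - 1) ≤
        ∑ y ∈ Y, ∑ x ∈ X with f x = y, (E x - 1) := by
      apply Finset.sum_le_sum_of_subset
      intro y hy
      simp only [Finset.mem_insert, Finset.mem_singleton] at hy
      rcases hy with rfl | rfl <;> assumption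
    rw [Finset.sum_pair hne.symm, ← htot] at h2
    have a1 := hs y₀ hy₀
    have a2 := hs y₁ hy₁
    have a3 := hcard y₀ hy₀
    have a4 := hcard y₁ hy₁
    have a5 := hhalf y₀ hnd
    have a6 := hhalf y₁ hnd₁
    constructor
    · omega
    · intro h; omega
  · push Not at hex
    have hcop : Nat.Coprime t (ε y₀) := by
      have h1 : Nat.gcd t (ε y₀) ∣ p := by
        rw [← hsum, ← Finset.add_sum_erase Y ε hy₀]
        apply dvd_add (Nat.gcd_dvd_right _ _)
        apply Finset.dvd_sum
        intro y hy
        exact (Nat.gcd_dvd_left _ _).trans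
          (hex y (Finset.mem_of_mem_erase hy) (Finset.ne_of_mem_erase hy))
      rcases (Nat.dvd_prime hp).1 h1 with h | h
      · exact h
      · have := Nat.le_of_dvd (by omega) (Nat.gcd_dvd_left t (ε y₀))
        omega
    have a1 := hs y₀ hy₀
    have a2 := hcard y₀ hy₀
    rw [hcop] at a2
    have a3 := Finset.single_le_sum (f := fun y => ∑ x ∈ X with f x = y, (E x - 1))
      (fun _ _ => Nat.zero_le _) hy₀
    simp only [← htot] at a3
    refine ⟨by omega, fun _ => ⟨y₀, hy₀, hcop, ?_, hex⟩⟩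
    have hne : (X.filter (f · = y₀)).card ≠ 0 := by
      intro h
      have := hEs y₀ hy₀
      rw [Finset.card_eq_zero.1 h, Finset.sum_empty] at this
      omega
    obtain ⟨x, hx⟩ := Finset.card_eq_one.1 (by omega : (X.filter (f · = y₀)).card = 1)
    have b1 := hEs y₀ hy₀
    have b2 := hfib y₀ hy₀
    rw [hx, Finset.sum_singleton] at b1 b2
    have hm : x ∈ X.filter (f · = y₀) := by rw [hx]; simp
    rw [Finset.mem_filter] at hm
    exact ⟨x, hm.1, hm.2, b1, b2⟩

section
variable {K : Type*} [Field K] {p : ℕ} [Fact p.Prime]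

/-- ramification index of `P` at `x` -/
noncomputable def rami (P : K[X]) (x : K) : ℕ := (P - C (P.eval x)).rootMultiplicity x

theorem sub_C_ne_zero (P : K[X]) (hd : P.natDegree = p) (c : K) : P - C c ≠ 0 := by
  intro h
  rw [sub_eq_zero] at h
  rw [h, natDegree_C] at hd
  exact (Fact.out : p.Prime).ne_zero hd.symm

theorem rami_pos (P : K[X]) (hd : P.natDegree = p) (x : K) : 0 < rami P x := by
  unfold rami
  rw [rootMultiplicity_pos (sub_C_ne_zero P hd _)]
  simp

theorem rami_comp (g h : K[X]) (hg : g.natDegree = p) (hh : h.natDegree = p) (x : K) :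
    rami (g.comp h) x = rami g (h.eval x) * rami h x := by
  set y := h.eval x with hy
  obtain ⟨r, hr, hr0⟩ := exists_eq_pow_rootMultiplicity_mul_and_not_dvd (g - C (g.eval y))
    (sub_C_ne_zero g hg _) y
  change g - C (g.eval y) = (X - C y) ^ rami g y * r at hr
  have h1 : g.comp h - C ((g.comp h).eval x) = (h - C y) ^ rami g y * r.comp h := by
    have := congrArg (fun P => P.comp h) hr
    simp only [sub_comp, C_comp, mul_comp, pow_comp, X_comp] at this
    rw [eval_comp, ← hy, this]
  have h2 : ¬ (r.comp h).IsRoot x := by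
    rw [IsRoot, eval_comp, ← hy]
    intro h
    exact hr0 (dvd_iff_isRoot.2 h)
  have h3 : (h - C y) ^ rami g y * r.comp h ≠ 0 := by
    refine mul_ne_zero (pow_ne_zero _ (sub_C_ne_zero h hh _)) ?_
    intro h
    rw [h] at h2
    simp at h2
  unfold rami at *
  rw [h1, rootMultiplicity_mul h3, rootMultiplicity_eq_zero h2, add_zero]
  rw [hy]
  have : ∀ n, ((h - C (h.eval x)) ^ n).rootMultiplicity x =
      n * (h - C (h.eval x)).rootMultiplicity x := by
    intro n
    classical
    rw [← count_roots, roots_pow, Multiset.count_nsmul, count_roots]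
  rw [this]

variable [CharP K p]

theorem rami_lt (P : K[X]) (hm : P.Monic) (hd : P.natDegree = p) (hs : derivative P ≠ 0) (x : K) :
    rami P x < p := by
  have hle : rami P x ≤ p := by
    rw [← hd, ← natDegree_sub_C (a := P.eval x)]
    classical
    unfold rami
    rw [← count_roots]
    exact (Multiset.count_le_card _ _).trans (card_roots' _)
  rcases hle.lt_or_eq with h | h
  · exact h
  exfalso
  have h1 := pow_rootMultiplicity_dvd (P - C (P.eval x)) x
  change _ ^ rami P x ∣ _ at h1
  rw [h] at h1
  obtain ⟨r, hr⟩ := h1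
  have hX : (X - C x : K[X]) ≠ 0 := X_sub_C_ne_zero x
  have hr0 : r ≠ 0 := by
    rintro rfl
    rw [mul_zero] at hr
    exact sub_C_ne_zero P hd _ hr
  have h2 := congrArg natDegree hr
  rw [natDegree_sub_C, hd, natDegree_mul (pow_ne_zero _ hX) hr0, natDegree_pow, natDegree_X_sub_C]
    at h2
  have h3 : r.natDegree = 0 := by omega
  rw [eq_C_of_natDegree_eq_zero h3] at hr
  apply hs
  have : derivative P = derivative (P - C (P.eval x)) := by simp
  rw [this, hr]
  simp [derivative_mul, derivative_pow, CharP.cast_eq_zero K p]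

theorem rootMultiplicity_derivative (P : K[X]) (hm : P.Monic) (hd : P.natDegree = p)
    (hs : derivative P ≠ 0) (x : K) : (derivative P).rootMultiplicity x = rami P x - 1 := by
  have : derivative P = derivative (P - C (P.eval x)) := by simp
  rw [this]
  apply derivative_rootMultiplicity_of_root_of_mem_nonZeroDivisors
  · simp
  · rw [mem_nonZeroDivisors_iff_ne_zero]
    exact natCast_ne_zero_of_lt (p := p) _ (rami_pos P hd x) (rami_lt P hm hd hs x)

variable [IsAlgClosed K]

open Classical in
/-- the fibre of `P` over `c` -/
noncomputable def fib (P : K[X]) (c : K) : Finset K := (P - C c).roots.toFinset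

theorem mem_fib (P : K[X]) (hd : P.natDegree = p) (c x : K) : x ∈ fib P c ↔ P.eval x = c := by
  classical
  unfold fib
  rw [Multiset.mem_toFinset, mem_roots (sub_C_ne_zero P hd _)]
  simp [sub_eq_zero]

open Classical in
theorem count_fib (P : K[X]) (hd : P.natDegree = p) (c x : K) (hx : P.eval x = c) :
    (P - C c).roots.count x = rami P x := by
  rw [count_roots, rami, hx]

theorem sum_fib (P : K[X]) (hd : P.natDegree = p) (c : K) : ∑ x ∈ fib P c, rami P x = p := by
  classical
  rw [← card_roots_sub P hd c, ← Multiset.toFinset_sum_count_eq]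
  unfold fib
  apply Finset.sum_congr (by congr)
  intro x hx
  rw [count_fib P hd c x]
  rwa [← mem_fib P hd]

open Classical in
theorem Coll.rami_sum {g₁ h₁ g₂ h₂ : K[X]} (H : Coll p g₁ h₁ g₂ h₂) (y z : K)
    (hyz : g₁.eval y = g₂.eval z) :
    ∑ x ∈ fib h₂ z with h₁.eval x = y, rami h₂ x = rami g₁ y := by
  rw [← count_fib g₁ H.dg₁ _ y hyz, H.roots_eq z, Multiset.count_map,
    ← Multiset.toFinset_sum_count_eq, Multiset.toFinset_filter]
  unfold fib
  have : ((h₂ - C z).roots.toFinset.filter fun x => h₁.eval x = y) =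
    ((h₂ - C z).roots.toFinset.filter fun x => y = h₁.eval x) := by
    ext; simp [eq_comm]
  rw [this]
  apply Finset.sum_congr rfl
  intro x hx
  rw [Finset.mem_filter] at hx
  rw [Multiset.count_filter, if_pos hx.2, count_fib h₂ H.dh₂]
  rw [← mem_fib h₂ H.dh₂]
  exact hx.1

open Classical in
theorem card_roots_derivative (P : K[X]) (hm : P.Monic) (hd : P.natDegree = p)
    (hs : derivative P ≠ 0) :
    (derivative P).natDegree = ∑ x ∈ (derivative P).roots.toFinset, (rami P x - 1) := by
  rw [(IsAlgClosed.splits (derivative P)).natDegree_eq_card_roots, ← Multiset.toFinset_sum_count_eq]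
  apply Finset.sum_congr rfl
  intro x _
  rw [count_roots, rootMultiplicity_derivative P hm hd hs]

open Classical in
theorem mem_roots_derivative (P : K[X]) (hm : P.Monic) (hd : P.natDegree = p)
    (hs : derivative P ≠ 0) (x : K) : x ∈ (derivative P).roots.toFinset ↔ 1 < rami P x := by
  rw [Multiset.mem_toFinset, ← Multiset.count_pos, count_roots, rootMultiplicity_derivative P hm hd hs]
  omega

theorem sum_rami_le (P : K[X]) (hm : P.Monic) (hd : P.natDegree = p)
    (hs : derivative P ≠ 0) (S : Finset K) : ∑ x ∈ S, (rami P x - 1) ≤ (derivative P).natDegree := by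
  classical
  rw [card_roots_derivative P hm hd hs, ← Finset.sum_filter_add_sum_filter_not S (fun x => 1 < rami P x)]
  have : ∑ x ∈ S with ¬ 1 < rami P x, (rami P x - 1) = 0 := by
    apply Finset.sum_eq_zero
    intro x hx
    have := (Finset.mem_filter.1 hx).2
    omega
  rw [this, add_zero]
  apply Finset.sum_le_sum_of_subset
  intro x hx
  rw [mem_roots_derivative P hm hd hs]
  exact (Finset.mem_filter.1 hx).2

/-- local structure over a ramified point `z` of `g₂`. -/
theorem Coll.local_structure {g₁ h₁ g₂ h₂ : K[X]} (H : Coll p g₁ h₁ g₂ h₂) (z : K)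
    (hz : 1 < rami g₂ z) :
    ∃ y₀, g₁.eval y₀ = g₂.eval z ∧ Nat.Coprime (rami g₂ z) (rami g₁ y₀) ∧
      (∃ x, h₁.eval x = y₀ ∧ h₂.eval x = z ∧ rami h₁ x = rami g₂ z ∧ rami h₂ x = rami g₁ y₀) ∧
      ∀ y, g₁.eval y = g₂.eval z → y ≠ y₀ → rami g₂ z ∣ rami g₁ y := by
  classical
  have hpp := (Fact.out : p.Prime)
  have hkey : ∀ z, 1 < rami g₂ z → _ := fun z hz => comb_aux (fib h₂ z) (fib g₁ (g₂.eval z))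
    (fun x => h₁.eval x) (rami h₁) (rami h₂) (rami g₁) p (rami g₂ z) hpp hz
    (rami_lt g₂ H.mg₂ H.dg₂ H.symm.sep_g₁ z)
    (by
      intro x hx
      rw [mem_fib h₂ H.dh₂] at hx
      rw [mem_fib g₁ H.dg₁, ← eval_comp, H.eq, eval_comp, hx])
    (fun x _ => rami_pos h₁ H.dh₁ x) (fun y _ => rami_pos g₁ H.dg₁ y)
    (sum_fib g₁ H.dg₁ _)
    (by
      intro x hx
      rw [mem_fib h₂ H.dh₂] at hx
      rw [← rami_comp g₁ h₁ H.dg₁ H.dh₁, H.eq, rami_comp g₂ h₂ H.dg₂ H.dh₂, hx])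
    (by
      intro y hy
      rw [mem_fib g₁ H.dg₁] at hy
      exact H.rami_sum y z hy)
  have hT := card_roots_derivative g₂ H.mg₂ H.dg₂ H.symm.sep_g₁
  set T := (derivative g₂).roots.toFinset with hTdef
  have hzT : ∀ z, z ∈ T ↔ 1 < rami g₂ z := mem_roots_derivative g₂ H.mg₂ H.dg₂ H.symm.sep_g₁
  have hle : ∀ z ∈ T, rami g₂ z - 1 ≤ ∑ x ∈ fib h₂ z, (rami h₁ x - 1) :=
    fun z hz => (hkey z ((hzT z).1 hz)).1
  have hdisj : (T : Set K).PairwiseDisjoint (fib h₂) := by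
    intro a _ b _ hab
    rw [Function.onFun, Finset.disjoint_left]
    intro x hxa hxb
    rw [mem_fib h₂ H.dh₂] at hxa hxb
    exact hab (hxa.symm.trans hxb)
  have hup : ∑ z ∈ T, ∑ x ∈ fib h₂ z, (rami h₁ x - 1) ≤ ∑ z ∈ T, (rami g₂ z - 1) := by
    rw [← Finset.sum_biUnion hdisj, ← hT, ← H.natDegree_eq.1, ← H.natDegree_D]
    exact sum_rami_le h₁ H.mh₁ H.dh₁ H.sep_h₁ _
  have heq := (Finset.sum_eq_sum_iff_of_le hle).1 (le_antisymm (Finset.sum_le_sum hle) hup)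
  obtain ⟨y₀, hy₀, hc, ⟨x, hx, hx1, hx2, hx3⟩, hall⟩ :=
    (hkey z hz).2 (heq z ((hzT z).2 hz)).symm
  rw [mem_fib g₁ H.dg₁] at hy₀
  rw [mem_fib h₂ H.dh₂] at hx
  refine ⟨y₀, hy₀, hc, ⟨x, hx1, hx, hx2, hx3⟩, ?_⟩
  intro y hy hne
  exact hall y ((mem_fib g₁ H.dg₁ _ _).2 hy) hne

theorem Coll.exists_over {g₁ h₁ g₂ h₂ : K[X]} (H : Coll p g₁ h₁ g₂ h₂) (y z : K)
    (hyz : g₁.eval y = g₂.eval z) : ∃ x, h₁.eval x = y ∧ h₂.eval x = z := by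
  classical
  have := H.rami_sum y z hyz
  have h0 := rami_pos g₁ H.dg₁ y
  rw [← this] at h0
  obtain ⟨x, hx, _⟩ := Finset.exists_ne_zero_of_sum_ne_zero h0.ne'
  rw [Finset.mem_filter, mem_fib h₂ H.dh₂] at hx
  exact ⟨x, hx.2, hx.1⟩

end


open Polynomial

set_option linter.unusedSectionVars false
set_option linter.unusedSimpArgs false
set_option linter.deprecated false
set_option linter.unusedVariables false

theorem comb_half {α β : Type*} (Y : Finset α) (Z : Finset β)
    (e : α → ℕ) (f : β → ℕ) (p m : ℕ) 
    (hes : ∑ y ∈ Y, e y = p) (hep : ∀ y ∈ Y, e y < p) (he0 : ∀ y ∈ Y, 0 < e y)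
    (hfm : ∀ z ∈ Z, f z ≤ m) 
    (L1 : ∀ z ∈ Z, 1 < f z → ∃ y₀ ∈ Y, Nat.Coprime (f z) (e y₀) ∧ ∀ y ∈ Y, y ≠ y₀ → f z ∣ e y)
    (z₁ : β) (hz₁ : z₁ ∈ Z) (hf1 : 1 < f z₁) : ∃ y ∈ Y, f z₁ ≤ e y := by
  classical
  obtain ⟨y₀, hy₀, -, h⟩ := L1 z₁ hz₁ hf1
  have : ∃ y ∈ Y, y ≠ y₀ := by
    by_contra hc
    push Not at hc
    have : Y = {y₀} := by
      ext y; simp; exact ⟨hc y, fun h => h ▸ hy₀⟩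
    rw [this, Finset.sum_singleton] at hes
    have := hep y₀ hy₀
    omega
  obtain ⟨y, hy, hne⟩ := this
  exact ⟨y, hy, Nat.le_of_dvd (he0 y hy) (h y hy hne)⟩

theorem comb_half2 {α β : Type*} (Y : Finset α) (Z : Finset β)
    (e : α → ℕ) (f : β → ℕ) (p m : ℕ) 
    (he0 : ∀ y ∈ Y, 0 < e y) (hem : ∀ y ∈ Y, e y ≤ m) 
    (L1 : ∀ z ∈ Z, 1 < f z → ∃ y₀ ∈ Y, Nat.Coprime (f z) (e y₀) ∧ ∀ y ∈ Y, y ≠ y₀ → f z ∣ e y)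
    (z₁ : β) (hz₁ : z₁ ∈ Z) (hf1 : 1 < f z₁) (hm : f z₁ = m) :
    ∃ y₀ ∈ Y, Nat.Coprime m (e y₀) ∧ e y₀ < m ∧ ∀ y ∈ Y, y ≠ y₀ → e y = m := by
  obtain ⟨y₀, hy₀, hc, h⟩ := L1 z₁ hz₁ hf1
  rw [hm] at hc
  refine ⟨y₀, hy₀, hc, ?_, ?_⟩
  · refine lt_of_le_of_ne (hem _ hy₀) fun h => ?_
    rw [h, Nat.coprime_self] at hc
    omega
  · intro y hy hne
    exact le_antisymm (hem y hy) (hm ▸ Nat.le_of_dvd (he0 y hy) (h y hy hne))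

theorem sum_eq_aux {α : Type*} (Y : Finset α) (e : α → ℕ) (m : ℕ) (y₀ : α) (hy₀ : y₀ ∈ Y)
    (h : ∀ y ∈ Y, y ≠ y₀ → e y = m) : ∑ y ∈ Y, e y = m * (Y.card - 1) + e y₀ := by
  classical
  rw [← Finset.sum_erase_add Y _ hy₀, Finset.sum_congr rfl (g := fun _ => m)]
  · rw [Finset.sum_const, Finset.card_erase_of_mem hy₀, smul_eq_mul, mul_comm]
  · intro y hy
    rw [Finset.mem_erase] at hy
    exact h y hy.2 hy.1

theorem comb_fibre {α β : Type*} (Y : Finset α) (Z : Finset β)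
    (e : α → ℕ) (f : β → ℕ) (p : ℕ)
    (hes : ∑ y ∈ Y, e y = p) (hep : ∀ y ∈ Y, e y < p) (he0 : ∀ y ∈ Y, 0 < e y)
    (hfs : ∑ z ∈ Z, f z = p) (hfp : ∀ z ∈ Z, f z < p) (hf0 : ∀ z ∈ Z, 0 < f z)
    (L1 : ∀ z ∈ Z, 1 < f z → ∃ y₀ ∈ Y, Nat.Coprime (f z) (e y₀) ∧ ∀ y ∈ Y, y ≠ y₀ → f z ∣ e y)
    (L2 : ∀ y ∈ Y, 1 < e y → ∃ z₀ ∈ Z, Nat.Coprime (e y) (f z₀) ∧ ∀ z ∈ Z, z ≠ z₀ → e y ∣ f z)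
    (z : β) (hz : z ∈ Z) (hz1 : 1 < f z) :
    ∃ m r, ∃ y₀ ∈ Y, ∃ z₀ ∈ Z, 1 < m ∧ 0 < r ∧ r < m ∧ Nat.Coprime m r ∧ e y₀ = r ∧ f z₀ = r ∧
      (∀ y ∈ Y, y ≠ y₀ → e y = m) ∧ (∀ z ∈ Z, z ≠ z₀ → f z = m) ∧ 
      p = m * (Y.card - 1) + r ∧ Y.card = Z.card ∧ 1 < Y.card ∧ (1 < r → Y.card = 2) := by
  classical
  obtain ⟨z₁, hz₁, hmax1⟩ := Finset.exists_max_image Z f ⟨z, hz⟩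
  have hf1 : 1 < f z₁ := lt_of_lt_of_le hz1 (hmax1 z hz)
  obtain ⟨y, hy, hym⟩ := comb_half Y Z e f p (f z₁) hes hep he0 hmax1 L1 z₁ hz₁ hf1
  obtain ⟨y₁, hy₁, hmax2⟩ := Finset.exists_max_image Y e ⟨y, hy⟩
  have he1 : 1 < e y₁ := lt_of_lt_of_le (lt_of_lt_of_le hf1 hym) (hmax2 y hy)
  obtain ⟨z', hz', hzm'⟩ := comb_half Z Y f e p (e y₁) hfs hfp hf0 hmax2 L2 y₁ hy₁ he1
  have hm : f z₁ = e y₁ := le_antisymm (hym.trans (hmax2 y hy)) (hzm'.trans (hmax1 z' hz'))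
  obtain ⟨y₀, hy₀, hc, hlt, hY⟩ := comb_half2 Y Z e f p (f z₁) he0 (by rw [hm]; exact hmax2) L1 z₁ hz₁ hf1 rfl
  obtain ⟨z₀, hz₀, hc', hlt', hZ⟩ := comb_half2 Z Y f e p (f z₁) hf0 hmax1 L2 y₁ hy₁ he1 hm.symm
  set m := f z₁ with hmd
  have s1 := sum_eq_aux Y e m y₀ hy₀ hY
  have s2 := sum_eq_aux Z f m z₀ hz₀ hZ
  rw [hes] at s1
  rw [hfs] at s2
  have hr : e y₀ = f z₀ := by
    have h1 : p % m = e y₀ := by rw [s1, Nat.mul_add_mod, Nat.mod_eq_of_lt hlt]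
    have h2 : p % m = f z₀ := by rw [s2, Nat.mul_add_mod, Nat.mod_eq_of_lt hlt']
    rw [← h1, h2]
  have hcard : Y.card = Z.card := by
    have : m * (Y.card - 1) = m * (Z.card - 1) := by omega
    have := Nat.eq_of_mul_eq_mul_left (by omega) this
    have h1 := Finset.card_pos.2 ⟨y₀, hy₀⟩
    have h2 := Finset.card_pos.2 ⟨z₀, hz₀⟩
    omega
  have hYc : 1 < Y.card := by
    by_contra hcc
    have : Y.card - 1 = 0 := by omega
    rw [this] at s1
    have := hep y₀ hy₀
    omega
  refine ⟨m, e y₀, y₀, hy₀, z₀, hz₀, hf1, he0 y₀ hy₀, hlt, hc, rfl, hr.symm, hY, hZ, s1, hcard, hYc, ?_⟩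
  intro hr1
  obtain ⟨y', hy', hcop, hdiv⟩ := L1 z₀ hz₀ (hr ▸ hr1)
  rw [← hr] at hcop hdiv
  have hne : y' ≠ y₀ := by
    rintro rfl
    rw [Nat.coprime_self] at hcop; omega
  have : Y = {y₀, y'} := by
    ext y
    simp only [Finset.mem_insert, Finset.mem_singleton]
    constructor
    · intro hy
      by_contra hcon
      push Not at hcon
      have h1 := hdiv y hy hcon.2
      rw [hY y hy hcon.1] at h1
      have := Nat.dvd_gcd h1 dvd_rfl
      rw [hc.gcd_eq_one] at this
      have := Nat.le_of_dvd one_pos this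
      omega
    · rintro (rfl | rfl) <;> assumption
  rw [this, Finset.card_pair hne.symm]

section
variable {K : Type*} [Field K] {p : ℕ} [Fact p.Prime] [CharP K p] [IsAlgClosed K]

theorem Coll.fibre {g₁ h₁ g₂ h₂ : K[X]} (H : Coll p g₁ h₁ g₂ h₂) (z : K) (hz : 1 < rami g₂ z) :
    ∃ m r, ∃ y₀ ∈ fib g₁ (g₂.eval z), ∃ z₀ ∈ fib g₂ (g₂.eval z), 1 < m ∧ 0 < r ∧ r < m ∧ 
      Nat.Coprime m r ∧ rami g₁ y₀ = r ∧ rami g₂ z₀ = r ∧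
      (∀ y ∈ fib g₁ (g₂.eval z), y ≠ y₀ → rami g₁ y = m) ∧ 
      (∀ z' ∈ fib g₂ (g₂.eval z), z' ≠ z₀ → rami g₂ z' = m) ∧ 
      p = m * ((fib g₁ (g₂.eval z)).card - 1) + r ∧ 
      (fib g₁ (g₂.eval z)).card = (fib g₂ (g₂.eval z)).card ∧ 1 < (fib g₁ (g₂.eval z)).card ∧ 
      (1 < r → (fib g₁ (g₂.eval z)).card = 2) := by
  apply comb_fibre
  · exact sum_fib g₁ H.dg₁ _
  · exact fun y _ => rami_lt g₁ H.mg₁ H.dg₁ H.sep_g₁ y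
  · exact fun y _ => rami_pos g₁ H.dg₁ y
  · exact sum_fib g₂ H.dg₂ _
  · exact fun y _ => rami_lt g₂ H.mg₂ H.dg₂ H.symm.sep_g₁ y
  · exact fun y _ => rami_pos g₂ H.dg₂ y
  · intro z' hz' hf
    rw [mem_fib g₂ H.dg₂] at hz'
    obtain ⟨y₀, h1, h2, -, h3⟩ := H.local_structure z' hf
    refine ⟨y₀, ?_, h2, ?_⟩
    · rw [mem_fib g₁ H.dg₁, h1, hz']
    · intro y hy
      rw [mem_fib g₁ H.dg₁, ← hz'] at hy
      exact h3 y hy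
  · intro z' hz' hf
    rw [mem_fib g₁ H.dg₁] at hz'
    obtain ⟨y₀, h1, h2, -, h3⟩ := H.symm.local_structure z' hf
    refine ⟨y₀, ?_, h2, ?_⟩
    · rw [mem_fib g₂ H.dg₂, h1, hz']
    · intro y hy
      rw [mem_fib g₂ H.dg₂, ← hz'] at hy
      exact h3 y hy
  · show z ∈ _
    rw [mem_fib g₂ H.dg₂]
  · exact hz

theorem sum_pred {α : Type*} (Y : Finset α) (e : α → ℕ) (he0 : ∀ y ∈ Y, 0 < e y) :
    ∑ y ∈ Y, (e y - 1) + Y.card = ∑ y ∈ Y, e y := by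
  rw [Finset.card_eq_sum_ones, ← Finset.sum_add_distrib]
  apply Finset.sum_congr rfl
  intro y hy
  have := he0 y hy
  omega

/-- size of a ramified fibre -/
theorem Coll.fibre_card_le {g₁ h₁ g₂ h₂ : K[X]} (H : Coll p g₁ h₁ g₂ h₂) (z : K)
    (hz : 1 < rami g₂ z) : 2 * (fib g₂ (g₂.eval z)).card ≤ p + 1 := by
  obtain ⟨m, r, y₀, hy₀, z₀, hz₀, hm, hr, hrm, -, -, -, -, -, hp, hc, hc1, -⟩ := H.fibre z hz
  rw [← hc]
  have : 2 * ((fib g₁ (g₂.eval z)).card - 1) ≤ m * ((fib g₁ (g₂.eval z)).card - 1) :=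
    Nat.mul_le_mul_right _ hm
  omega

theorem Coll.natDegree_fibre {g₁ h₁ g₂ h₂ : K[X]} (H : Coll p g₁ h₁ g₂ h₂) (z : K)
    (hz : 1 < rami g₂ z) :
    (derivative g₂).natDegree + (fib g₂ (g₂.eval z)).card = p := by
  classical
  have hs2 := H.symm.sep_g₁
  rw [card_roots_derivative g₂ H.mg₂ H.dg₂ hs2, ← sum_fib g₂ H.dg₂ (g₂.eval z),
    ← sum_pred _ _ (fun y _ => rami_pos g₂ H.dg₂ y)]
  congr 1
  apply Finset.sum_subset_zero_on_sdiff
  · intro z' hz'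
    rw [mem_roots_derivative g₂ H.mg₂ H.dg₂ hs2] at hz'
    rw [mem_fib g₂ H.dg₂]
    by_contra hne
    have h1 := sum_rami_le g₂ H.mg₂ H.dg₂ hs2 (fib g₂ (g₂.eval z) ∪ fib g₂ (g₂.eval z'))
    rw [Finset.sum_union] at h1
    · have h2 := sum_pred (fib g₂ (g₂.eval z)) (rami g₂) (fun y _ => rami_pos g₂ H.dg₂ y)
      have h3 := sum_pred (fib g₂ (g₂.eval z')) (rami g₂) (fun y _ => rami_pos g₂ H.dg₂ y)
      rw [sum_fib g₂ H.dg₂] at h2 h3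
      have h4 := H.fibre_card_le z hz
      have h5 := H.fibre_card_le z' hz'
      have h6 := natDegree_derivative_le_p g₂ H.mg₂ H.dg₂
      have := (Fact.out : p.Prime).two_le
      omega
    · rw [Finset.disjoint_left]
      intro x hx hx'
      rw [mem_fib g₂ H.dg₂] at hx hx'
      exact hne (hx'.symm.trans hx)
  · intro x hx
    rw [Finset.mem_sdiff, mem_roots_derivative g₂ H.mg₂ H.dg₂ hs2] at hx
    omega
  · intros; rfl

/-- reconstruction from a full fibre -/
theorem eq_prod_of_fibre {ι : Type*} (P : K[X]) (hm : P.Monic) (hd : P.natDegree = p) (y : K) (S : Finset ι) (x : ι → K)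
    (n : ι → ℕ) (hinj : Set.InjOn x S) (hx : ∀ i ∈ S, P.eval (x i) = y) (hn : ∀ i ∈ S, n i ≤ rami P (x i))
    (hs : ∑ i ∈ S, n i = p) : P - C y = ∏ i ∈ S, (X - C (x i)) ^ n i := by
  have hdvd : ∏ i ∈ S, (X - C (x i)) ^ n i ∣ P - C y := by
    apply Finset.prod_dvd_of_coprime
    · intro i hi j hj hij
      exact (isCoprime_X_sub_C_of_isUnit_sub 
        (sub_ne_zero.2 (fun h => hij (hinj hi hj h))).isUnit).pow
    · intro i hi
      rw [← le_rootMultiplicity_iff (sub_C_ne_zero P hd y), ← hx i hi]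
      exact hn i hi
  have hmon : (∏ i ∈ S, (X - C (x i)) ^ n i).Monic := 
    monic_prod_of_monic _ _ fun i _ => (monic_X_sub_C _).pow _
  apply eq_of_monic_of_dvd_of_natDegree_le hmon (monic_sub_C' P hm hd y) hdvd
  rw [natDegree_sub_C' P hd, natDegree_prod_of_monic _ _ (fun i _ => (monic_X_sub_C _).pow _)]
  simp [natDegree_pow, hs]

end


open Polynomial

set_option linter.unusedSectionVars false
set_option linter.unusedSimpArgs false
set_option linter.deprecated false
set_option linter.unusedVariables false

section
variable {K : Type*} [Field K]

/-- normalisation to a polynomial vanishing at zero -/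
noncomputable def orig (P : K[X]) : K[X] := P - C (P.eval 0)

noncomputable def Sp (p m : ℕ) (β : K) : K[X] := X * (X ^ ((p - 1) / m) - C β) ^ m

noncomputable def hS (p m : ℕ) (w β : K) : K[X] := orig ((Sp p m β).comp (X - C w))

noncomputable def gS (p m : ℕ) (w α β : K) : K[X] :=
  orig ((Sp p m α).comp (X - C ((hS p m w β).eval w)))

noncomputable def hM0 (p m : ℕ) (w b a : K) : K[X] :=
  C (b ^ p)⁻¹ * (C a * (X - C w) ^ p + C (b ^ p - a) * (X - C w) ^ (p - m) * (X - C (w + b)) ^ m)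

noncomputable def hM (p m : ℕ) (w b a : K) : K[X] := orig (hM0 p m w b a)

noncomputable def gM (p m : ℕ) (w b a : K) : K[X] :=
  orig ((X - C ((hM p m w b a).eval w)) ^ m * (X - C ((hM p m w b a).eval w + a)) ^ (p - m))

theorem eq_orig (P Q : K[X]) (y : K) (hP : P.eval 0 = 0) (h : P - C y = Q) : P = orig Q := by
  rw [orig, ← h]
  simp [hP]

end

section
variable {K : Type*} [Field K] {p : ℕ} [Fact p.Prime] [CharP K p]

theorem lemmaS (P B : K[X]) (y w : K) (m l : ℕ) (hm : 0 < m) (hl : 0 < l) (hml : m * l = p - 1)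
    (hB : B.Monic) (hBd : B.natDegree = l) (hP : P - C y = (X - C w) * B ^ m)
    (hdeg : (derivative P).natDegree ≤ l * (m - 1)) (hs : derivative P ≠ 0) :
    ∃ β : K, β ≠ 0 ∧ B = (X - C w) ^ l - C β := by
  have hp2 := (Fact.out : p.Prime).two_le
  obtain ⟨k, rfl⟩ : ∃ k, m = k + 1 := ⟨m - 1, by omega⟩
  set E := B + C ((k + 1 : ℕ) : K) * (X - C w) * derivative B with hE
  have h1 : derivative P = B ^ k * E := by
    have : derivative P = derivative (P - C y) := by simp
    rw [this, hP, hE]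
    simp [derivative_mul, derivative_pow]
    ring
  have hE0 : E ≠ 0 := by
    intro h; rw [h, mul_zero] at h1; exact hs h1
  have hEd : E.natDegree = 0 := by
    rw [h1, natDegree_mul (pow_ne_zero _ hB.ne_zero) hE0, hB.natDegree_pow, hBd, Nat.add_sub_cancel,
      mul_comm] at hdeg
    omega
  obtain ⟨e, he⟩ := natDegree_eq_zero.1 hEd
  have he0 : e ≠ 0 := by rintro rfl; rw [← he] at hE0; simp at hE0
  set T := B.comp (X + C w) with hT
  have hTB : B = T.comp (X - C w) := by
    rw [hT, comp_assoc]; simp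
  have hTE : T + C ((k + 1 : ℕ) : K) * (X * derivative T) = C e := by
    have := congrArg (fun Q => Q.comp (X + C w)) (he.trans hE)
    simp only [C_comp, add_comp, mul_comp, sub_comp, X_comp, C_comp] at this
    rw [this, hT, derivative_comp]
    simp
    ring
  have hTm : T.Monic := hB.comp_X_add_C w
  have hTd : T.natDegree = l := by
    rw [hT, natDegree_comp, natDegree_X_add_C, hBd, mul_one]
  have hco : ∀ n, 1 + n ≤ l → 1 + n ≠ l → T.coeff (1 + n) = 0 := by
    intro n h1 h2
    have h := congrArg (fun Q => Q.coeff (n + 1)) hTE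
    simp only [coeff_add, coeff_C_mul, coeff_X_mul, coeff_derivative, coeff_C] at h
    rw [if_neg (by omega)] at h
    have h3 : T.coeff (n + 1) * ((1 + (k + 1) * (n + 1) : ℕ) : K) = 0 := by
      rw [← h]; push_cast; ring
    rw [add_comm]
    refine (mul_eq_zero.1 h3).resolve_right (natCast_ne_zero_of_lt (p := p) _ (by omega) ?_)
    have : (k + 1) * (n + 1) + (k+1) ≤ (k + 1) * l := by
      rw [← Nat.mul_succ]
      exact Nat.mul_le_mul_left _ (by omega)
    omega
  have hT0 : T.coeff 0 = e := by
    have h := congrArg (fun Q => Q.coeff 0) hTE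
    simpa [coeff_C] using h
  have hTX : T = X ^ l - C (-e) := by
    ext n
    rw [coeff_sub, coeff_X_pow, coeff_C]
    rcases Nat.eq_zero_or_pos n with rfl | hn
    · rw [if_neg hl.ne, if_pos rfl, hT0]; ring
    · rw [if_neg hn.ne']
      by_cases hnl : n = l
      · rw [if_pos hnl, hnl, ← hTd]; simp [hTm.coeff_natDegree]
      · rw [if_neg hnl, sub_zero]
        rcases lt_or_gt_of_ne hnl with h | h
        · obtain ⟨j, rfl⟩ : ∃ j, n = 1 + j := ⟨n - 1, by omega⟩
          exact hco j h.le hnl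
        · exact coeff_eq_zero_of_natDegree_lt (by omega)
  refine ⟨-e, neg_ne_zero.2 he0, ?_⟩
  rw [hTB, hTX]
  simp

theorem lemmaS' (P B : K[X]) (y w : K) (m l : ℕ) (hm : 0 < m) (hl : 0 < l) (hml : m * l = p - 1)
    (hB : B.Monic) (hBd : B.natDegree = l) (hP : P - C y = (X - C w) * B ^ m)
    (hdeg : (derivative P).natDegree ≤ l * (m - 1)) (hs : derivative P ≠ 0) :
    ∃ β : K, β ≠ 0 ∧ P - C y = (Sp p m β).comp (X - C w) := by
  obtain ⟨β, h0, h⟩ := lemmaS P B y w m l hm hl hml hB hBd hP hdeg hs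
  refine ⟨β, h0, ?_⟩
  have : (p - 1) / m = l := by rw [← hml, Nat.mul_div_cancel_left _ hm]
  rw [hP, h, Sp, this]
  simp

theorem lemmaM [IsAlgClosed K] (P : K[X]) (hmon : P.Monic) (hd : P.natDegree = p) (x₁ x₂ : K) (m r : ℕ)
    (hmr : r + m = p) (hr0 : 0 < r) (hm0 : 0 < m) (hne : x₁ ≠ x₂) (hr : r ≤ rami P x₁) (hm : m ≤ rami P x₂) :
    P - C (P.eval x₁) = hM0 p m x₁ (x₂ - x₁) (P.eval x₂ - P.eval x₁) := by
  set b := x₂ - x₁ with hb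
  set a := P.eval x₂ - P.eval x₁ with ha
  have hb0 : b ≠ 0 := sub_ne_zero.2 hne.symm
  have hbp : b ^ p ≠ 0 := pow_ne_zero _ hb0
  have hw : x₁ + b = x₂ := by rw [hb]; ring
  have hrr : p - m = r := by omega
  have hQ : hM0 p m x₁ b a = C (b ^ p)⁻¹ * (C a * (X - C x₁) ^ p + C (b ^ p - a) * (X - C x₁) ^ r * (X - C x₂) ^ m) := by
    rw [hM0, hw, hrr]
  set Q := hM0 p m x₁ b a with hQd
  have hCb : C (b ^ p)⁻¹ * C (b ^ p) = (1 : K[X]) := by rw [← C_mul, inv_mul_cancel₀ hbp, C_1]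
  have hv : (X - C x₂ : K[X]) ^ p = (X - C x₁) ^ p - C (b ^ p) := by
    rw [C_pow, ← sub_pow_char (p := p)]
    congr 1
    rw [hb]; simp
  have d1 : (X - C x₁) ^ r ∣ P - C (P.eval x₁) - Q := by
    apply dvd_sub
    · exact (pow_dvd_pow _ hr).trans (pow_rootMultiplicity_dvd _ _)
    · rw [hQ, ← hmr, pow_add (X - C x₁) r m]
      exact ⟨C (b ^ (r + m))⁻¹ * (C a * (X - C x₁) ^ m + C (b ^ (r + m) - a) * (X - C x₂) ^ m), by ring⟩
  have d2 : (X - C x₂) ^ m ∣ P - C (P.eval x₁) - Q := by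
    have : P - C (P.eval x₁) - Q = (P - C (P.eval x₂)) - C (b ^ p)⁻¹ * (C a * (X - C x₂) ^ p + C (b ^ p - a) * (X - C x₁) ^ r * (X - C x₂) ^ m) := by
      rw [hQ, hv]
      have : C (P.eval x₂) = C a + C (P.eval x₁) := by rw [ha, ← C_add]; simp
      rw [this]
      linear_combination (-C a) * hCb
    rw [this]
    apply dvd_sub
    · exact (pow_dvd_pow _ hm).trans (pow_rootMultiplicity_dvd _ _)
    · rw [← hmr, pow_add (X - C x₂) r m]
      exact ⟨C (b ^ (r + m))⁻¹ * (C a * (X - C x₂) ^ r + C (b ^ (r + m) - a) * (X - C x₁) ^ r), by ring⟩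
  have hco : IsCoprime ((X - C x₁ : K[X]) ^ r) ((X - C x₂) ^ m) :=
    (isCoprime_X_sub_C_of_isUnit_sub (sub_ne_zero.2 hne).isUnit).pow
  have hdvd := hco.mul_dvd d1 d2
  have hmonQ : (X - C x₁ : K[X]) ^ p + C (b ^ p)⁻¹ * C (b ^ p - a) * ((X - C x₁) ^ r * (X - C x₂) ^ m - (X - C x₁) ^ p) = Q := by
    rw [hQ, C_sub]
    linear_combination (-(X - C x₁)^p) * hCb
  by_contra hcon
  have hne0 : P - C (P.eval x₁) - Q ≠ 0 := sub_ne_zero.2 hcon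
  have hdeg := degree_le_of_dvd hdvd hne0
  have hd1 : ((X - C x₁ : K[X]) ^ r * (X - C x₂) ^ m).degree = (p : WithBot ℕ) := by
    rw [degree_mul, degree_pow, degree_pow, degree_X_sub_C, degree_X_sub_C, ← hmr]; simp
  have hd2 : ((X - C x₁ : K[X]) ^ p).degree = (p : WithBot ℕ) := by
    rw [degree_pow, degree_X_sub_C]; simp
  rw [hd1] at hdeg
  have hm1 : ((X - C x₁ : K[X]) ^ r * (X - C x₂) ^ m).Monic := ((monic_X_sub_C _).pow _).mul ((monic_X_sub_C _).pow _)
  have hm2 : ((X - C x₁ : K[X]) ^ p).Monic := (monic_X_sub_C _).pow _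
  have l1 : ((X - C x₁ : K[X]) ^ r * (X - C x₂) ^ m - (X - C x₁) ^ p).degree < (p : WithBot ℕ) := by
    rw [← hd1]
    exact degree_sub_lt (hd1.trans hd2.symm) hm1.ne_zero (by rw [hm1.leadingCoeff, hm2.leadingCoeff])
  have hm3 := monic_sub_C' P hmon hd (P.eval x₁)
  have hd3 : (P - C (P.eval x₁)).degree = (p : WithBot ℕ) := by
    rw [degree_eq_natDegree hm3.ne_zero, natDegree_sub_C' P hd]
  have l2 : (P - C (P.eval x₁) - (X - C x₁) ^ p).degree < (p : WithBot ℕ) := by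
    rw [← hd3]
    exact degree_sub_lt (hd3.trans hd2.symm) hm3.ne_zero (by rw [hm3.leadingCoeff, hm2.leadingCoeff])
  have : P - C (P.eval x₁) - Q = (P - C (P.eval x₁) - (X - C x₁) ^ p) - C ((b ^ p)⁻¹ * (b ^ p - a)) * ((X - C x₁ : K[X]) ^ r * (X - C x₂) ^ m - (X - C x₁) ^ p) := by
    rw [← hmonQ, C_mul]; ring
  rw [this] at hdeg
  have l3 : (C ((b ^ p)⁻¹ * (b ^ p - a)) * ((X - C x₁ : K[X]) ^ r * (X - C x₂) ^ m - (X - C x₁) ^ p)).degree < (p : WithBot ℕ) :=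
    lt_of_le_of_lt (by rw [C_mul']; exact degree_smul_le _ _) l1
  exact absurd (lt_of_le_of_lt (degree_sub_le _ _) (max_lt l2 l3)) (not_lt.2 hdeg)

end


open Polynomial

set_option linter.unusedSectionVars false
set_option linter.unusedSimpArgs false
set_option linter.deprecated false
set_option linter.unusedVariables false

section
variable {K : Type*} [Field K] {p : ℕ} [Fact p.Prime] [CharP K p] [IsAlgClosed K]

theorem formS_aux {g₁ h₁ : K[X]} (hg0 : g₁.eval 0 = 0) (hh0 : h₁.eval 0 = 0) (m : ℕ) (w y₀ c α β : K)
    (h1 : h₁ - C y₀ = (Sp p m β).comp (X - C w)) (h2 : g₁ - C c = (Sp p m α).comp (X - C y₀)) :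
    h₁ = hS p m w β ∧ g₁ = gS p m w α β := by
  have e1 : h₁ = hS p m w β := eq_orig _ _ _ hh0 h1
  have e2 : h₁.eval w = y₀ := by
    have := congrArg (eval w) h1
    simpa [Sp, sub_eq_zero] using this
  refine ⟨e1, ?_⟩
  rw [gS, ← e1, e2]
  exact eq_orig _ _ _ hg0 h2

theorem Coll.formS {g₁ h₁ g₂ h₂ : K[X]} (H : Coll p g₁ h₁ g₂ h₂) (m l : ℕ) (c y₀ z₀ w : K)
    (hm : 1 < m) (hl : 0 < l) (hml : m * l = p - 1)
    (hy₀ : y₀ ∈ fib g₁ c) (hz₀ : z₀ ∈ fib g₂ c) (ry : rami g₁ y₀ = 1) (rz : rami g₂ z₀ = 1)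
    (hY : ∀ y ∈ fib g₁ c, y ≠ y₀ → rami g₁ y = m) (hZ : ∀ z ∈ fib g₂ c, z ≠ z₀ → rami g₂ z = m)
    (hcy : (fib g₁ c).card = l + 1) (hcz : (fib g₂ c).card = l + 1)
    (hwy : h₁.eval w = y₀) (hwz : h₂.eval w = z₀)
    (hdeg : (derivative g₁).natDegree ≤ l * (m - 1)) :
    ∃ α β : K, α ≠ 0 ∧ β ≠ 0 ∧ h₁ = hS p m w β ∧ g₁ = gS p m w α β := by
  classical
  have hex : ∀ z, ∃ x, z ∈ fib g₂ c →
      h₁.eval x = y₀ ∧ h₂.eval x = z ∧ rami g₂ z ≤ rami h₁ x ∧ (z = z₀ → x = w) := by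
    intro z
    by_cases hz : z ∈ fib g₂ c
    · by_cases hzz : z = z₀
      · subst hzz
        exact ⟨w, fun _ => ⟨hwy, hwz, by rw [rz]; exact rami_pos h₁ H.dh₁ w, fun _ => rfl⟩⟩
      · have hr := hZ z hz hzz
        obtain ⟨y', h1, h2, ⟨x, hx1, hx2, hx3, hx4⟩, h3⟩ := H.local_structure z (by omega)
        have hy' : y' = y₀ := by
          by_contra hne
          rw [hY y' (by rw [mem_fib g₁ H.dg₁, h1]; rwa [mem_fib g₂ H.dg₂] at hz) hne, hr,
            Nat.coprime_self] at h2
          omega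
        exact ⟨x, fun _ => ⟨hx1.trans hy', hx2, hx3.ge, fun h => absurd h hzz⟩⟩
    · exact ⟨0, fun h => absurd h hz⟩
  choose x hx using hex
  have e1 := eq_prod_of_fibre h₁ H.mh₁ H.dh₁ y₀ (fib g₂ c) x (rami g₂) 
    (by
      intro i hi j hj hij
      rw [← (hx i hi).2.1, ← (hx j hj).2.1, hij]) (fun i hi => (hx i hi).1) 
    (fun i hi => (hx i hi).2.2.1) (sum_fib g₂ H.dg₂ c)
  have e2 := eq_prod_of_fibre g₁ H.mg₁ H.dg₁ c (fib g₁ c) id (rami g₁) 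
    (fun i hi j hj hij => hij) (fun i hi => by rwa [mem_fib g₁ H.dg₁] at hi) 
    (fun i hi => le_rfl) (sum_fib g₁ H.dg₁ c)
  have f1 : h₁ - C y₀ = (X - C w) * (∏ z ∈ (fib g₂ c).erase z₀, (X - C (x z))) ^ m := by
    rw [e1, ← Finset.mul_prod_erase _ _ hz₀, rz, pow_one, (hx z₀ hz₀).2.2.2 rfl, ← Finset.prod_pow]
    congr 1
    apply Finset.prod_congr rfl
    intro z hz
    rw [Finset.mem_erase] at hz
    rw [hZ z hz.2 hz.1]
  have f2 : g₁ - C c = (X - C y₀) * (∏ y ∈ (fib g₁ c).erase y₀, (X - C y)) ^ m := by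
    rw [e2, ← Finset.mul_prod_erase _ _ hy₀, ry, pow_one, ← Finset.prod_pow]
    congr 1
    apply Finset.prod_congr rfl
    intro z hz
    rw [Finset.mem_erase] at hz
    rw [hY z hz.2 hz.1, id]
  obtain ⟨β, hβ, k1⟩ := lemmaS' (p := p) h₁ _ y₀ w m l (by omega) hl hml (monic_prod_of_monic _ _ fun i _ => monic_X_sub_C _)
    (by rw [natDegree_prod_of_monic _ _ fun i _ => monic_X_sub_C _]; simp [Finset.card_erase_of_mem hz₀, hcz]) f1 (H.natDegree_D.trans_le hdeg) H.sep_h₁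
  obtain ⟨α, hα, k2⟩ := lemmaS' (p := p) g₁ _ c y₀ m l (by omega) hl hml (monic_prod_of_monic _ _ fun i _ => monic_X_sub_C _)
    (by rw [natDegree_prod_of_monic _ _ fun i _ => monic_X_sub_C _]; simp [Finset.card_erase_of_mem hy₀, hcy]) f2 hdeg H.sep_g₁
  exact ⟨α, β, hα, hβ, formS_aux H.og₁ H.oh₁ m w y₀ c α β k1 k2⟩

theorem formA_aux (P : K[X]) (hm : P.Monic) (hd : P.natDegree = p) (h0 : P.eval 0 = 0) (hdeg : (derivative P).natDegree = 0)
    (hs : derivative P ≠ 0) : ∃ β : K, β ≠ 0 ∧ P - C 0 = (Sp p 1 β).comp (X - C 0) := by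
  have hp2 := (Fact.out : p.Prime).two_le
  have hX : P = X * P.divX := by
    conv_lhs => rw [← divX_mul_X_add P, coeff_zero_eq_eval_zero, h0]
    simp [mul_comm]
  have hdd : P.divX.natDegree = p - 1 := by rw [natDegree_divX_eq_natDegree_tsub_one, hd]
  apply lemmaS' (p := p) P P.divX 0 0 1 (p - 1) one_pos (by omega) (by simp)
  · rw [hX] at hm
    exact monic_X.of_mul_monic_left hm
  · exact hdd
  · rw [C_0, sub_zero, sub_zero, pow_one, ← hX]
  · omega
  · exact hs

theorem Coll.formA {g₁ h₁ g₂ h₂ : K[X]} (H : Coll p g₁ h₁ g₂ h₂) (h : (derivative g₁).natDegree = 0) :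
    ∃ α β : K, α ≠ 0 ∧ β ≠ 0 ∧ h₁ = hS p 1 0 β ∧ g₁ = gS p 1 0 α β := by
  obtain ⟨β, hβ, k1⟩ := formA_aux h₁ H.mh₁ H.dh₁ H.oh₁ (H.natDegree_D.trans h) H.sep_h₁
  obtain ⟨α, hα, k2⟩ := formA_aux g₁ H.mg₁ H.dg₁ H.og₁ h H.sep_g₁
  exact ⟨α, β, hα, hβ, formS_aux H.og₁ H.oh₁ 1 0 0 0 α β k1 k2⟩

theorem formM_aux {g₁ h₁ : K[X]} (hg0 : g₁.eval 0 = 0) (hh0 : h₁.eval 0 = 0) (m r : ℕ) (hmr : r + m = p) (w y₁ y₀ c b a : K) 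
    (ha : a = y₀ - y₁) (hw : h₁.eval w = y₁)
    (h1 : h₁ - C y₁ = hM0 p m w b a) (h2 : g₁ - C c = (X - C y₁) ^ m * (X - C y₀) ^ r) :
    h₁ = hM p m w b a ∧ g₁ = gM p m w b a := by
  have e1 : h₁ = hM p m w b a := eq_orig _ _ _ hh0 h1
  refine ⟨e1, ?_⟩
  have : p - m = r := by omega
  rw [gM, ← e1, hw, this, show y₁ + a = y₀ by rw [ha]; ring]
  exact eq_orig _ _ _ hg0 h2

theorem eq_prod_two (g : K[X]) (hm : g.Monic) (hd : g.natDegree = p) (c y₀ y₁ : K) (m r : ℕ)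
    (hne : y₁ ≠ y₀) (hy0 : rami g y₀ = r) (hy1 : rami g y₁ = m) (hF : y₀ ∈ fib g c) (hF1 : y₁ ∈ fib g c)
    (hmr : r + m = p) : g - C c = (X - C y₁) ^ m * (X - C y₀) ^ r := by
  classical
  have e2 := eq_prod_of_fibre g hm hd c ({y₁, y₀} : Finset K) id (rami g) 
    (fun i hi j hj hij => hij) (fun i hi => by 
      rw [mem_fib g hd] at hF hF1
      simp at hi
      rcases hi with rfl | rfl <;> assumption) 
    (fun i hi => le_rfl) (by rw [Finset.sum_pair hne, hy0, hy1]; omega)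
  rw [e2, Finset.prod_pair hne, hy0, hy1]; rfl

theorem Coll.formM {g₁ h₁ g₂ h₂ : K[X]} (H : Coll p g₁ h₁ g₂ h₂) (m r : ℕ) (c y₀ y₁ z₀ z₁ : K)
    (hr : 1 < r) (hrm : r < m) (hmr : r + m = p) (hy₀ : y₀ ∈ fib g₁ c) (hz₀ : z₀ ∈ fib g₂ c)
    (hy₁ : y₁ ∈ fib g₁ c) (hz₁ : z₁ ∈ fib g₂ c) (hyn : y₁ ≠ y₀) (hzn : z₁ ≠ z₀)
    (ry₀ : rami g₁ y₀ = r) (ry₁ : rami g₁ y₁ = m) (rz₀ : rami g₂ z₀ = r) (rz₁ : rami g₂ z₁ = m)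
    (hY : ∀ y ∈ fib g₁ c, y = y₀ ∨ y = y₁) :
    ∃ w b a : K, b ≠ 0 ∧ a ≠ 0 ∧ a ≠ b ^ p ∧ h₁ = hM p m w b a ∧ g₁ = gM p m w b a ∧
      h₂ = hM p m (w + b) (-b) (a - b ^ p) ∧ g₂ = gM p m (w + b) (-b) (a - b ^ p) := by
  have my : ∀ y, y ∈ fib g₁ c ↔ g₁.eval y = c := mem_fib g₁ H.dg₁ c
  have mz : ∀ z, z ∈ fib g₂ c ↔ g₂.eval z = c := mem_fib g₂ H.dg₂ c
  have G1 := eq_prod_two g₁ H.mg₁ H.dg₁ c y₀ y₁ m r hyn ry₀ ry₁ hy₀ hy₁ hmr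
  have G2 := eq_prod_two g₂ H.mg₂ H.dg₂ c z₀ z₁ m r hzn rz₀ rz₁ hz₀ hz₁ hmr
  rw [my] at hy₀ hy₁
  rw [mz] at hz₀ hz₁
  obtain ⟨x₂, hx21, hx22, hx23, hx24⟩ : ∃ x, h₁.eval x = y₀ ∧ h₂.eval x = z₁ ∧ rami h₁ x = m ∧ rami h₂ x = r := by
    obtain ⟨y', h1, h2, ⟨x, hx1, hx2, hx3, hx4⟩, h3⟩ := H.local_structure z₁ (by omega)
    rw [hz₁, ← my] at h1
    rcases hY y' h1 with rfl | rfl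
    · exact ⟨x, hx1, hx2, hx3.trans rz₁, hx4.trans ry₀⟩
    · rw [rz₁, ry₁, Nat.coprime_self] at h2; omega
  obtain ⟨x₁, hx11, hx12, hx13, hx14⟩ : ∃ x, h₁.eval x = y₁ ∧ h₂.eval x = z₀ ∧ rami h₁ x = r ∧ rami h₂ x = m := by
    obtain ⟨y', h1, h2, ⟨x, hx1, hx2, hx3, hx4⟩, h3⟩ := H.local_structure z₀ (by omega)
    rw [hz₀, ← my] at h1
    rcases hY y' h1 with rfl | rfl
    · rw [rz₀, ry₀, Nat.coprime_self] at h2; omega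
    · exact ⟨x, hx1, hx2, hx3.trans rz₀, hx4.trans ry₁⟩
  have hx : x₁ ≠ x₂ := by
    rintro rfl
    exact hyn (hx11.symm.trans hx21)
  have E1 := lemmaM h₁ H.mh₁ H.dh₁ x₁ x₂ m r hmr (by omega) (by omega) hx hx13.ge hx23.ge
  have E2 := lemmaM h₂ H.mh₂ H.dh₂ x₂ x₁ m r hmr (by omega) (by omega) hx.symm hx24.ge hx14.ge
  rw [hx11, hx21] at E1
  rw [hx12, hx22] at E2
  set b := x₂ - x₁ with hb
  set a := y₀ - y₁ with ha
  set a' := z₀ - z₁ with ha'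
  have hb' : x₁ - x₂ = -b := by rw [hb]; ring
  have hw' : x₁ + b = x₂ := by rw [hb]; ring
  have hb0 : b ≠ 0 := sub_ne_zero.2 hx.symm
  rw [hb'] at E2
  have hbn : (-b) ^ p = - b ^ p := by
    have := (Fact.out : p.Prime)
    rcases this.eq_two_or_odd' with h | h
    · have h2 : (2 : K) = 0 := by
        have := CharP.cast_eq_zero K p
        rw [h] at this; exact_mod_cast this
      rw [h]
      linear_combination b ^ 2 * h2
    · exact h.neg_pow b
  have haa : a' = a - b ^ p := by
    obtain ⟨x, hxy, hxz⟩ := H.exists_over y₁ z₁ (hy₁.trans hz₁.symm)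
    have hu : x - x₁ ≠ 0 := by
      rw [sub_ne_zero]; rintro rfl
      exact hzn (hxz.symm.trans hx12)
    have hv : x - x₂ ≠ 0 := by
      rw [sub_ne_zero]; rintro rfl
      exact hyn (hxy.symm.trans hx21)
    have F1 := congrArg (eval x) E1
    have F2 := congrArg (eval x) E2
    have hpm : p - m = r := by omega
    have hbp := pow_ne_zero p hb0
    have hw2 : x₂ + -b = x₁ := by rw [hb]; ring
    simp only [hM0, hw', hw2, hpm, hbn, eval_sub, eval_mul, eval_add, eval_pow, eval_X, eval_C, hxy, hxz, sub_self] at F1 F2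
    have hpp : ∀ t : K, t ^ p = t ^ r * t ^ m := fun t => by rw [← pow_add, hmr]
    rw [hpp (x - x₁)] at F1
    rw [hpp (x - x₂)] at F2
    have F1' : a * (x - x₁) ^ m + (b ^ p - a) * (x - x₂) ^ m = 0 := by
      have h := (mul_eq_zero.1 F1.symm).resolve_left (inv_ne_zero hbp)
      have h2 : (x - x₁) ^ r * (a * (x - x₁) ^ m + (b ^ p - a) * (x - x₂) ^ m) = 0 := by rw [← h]; ring
      exact (mul_eq_zero.1 h2).resolve_left (pow_ne_zero _ hu)
    have F2' : a' * (x - x₂) ^ m + (-b ^ p - a') * (x - x₁) ^ m = 0 := by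
      have h := (mul_eq_zero.1 F2.symm).resolve_left (inv_ne_zero (neg_ne_zero.2 hbp))
      have h2 : (x - x₂) ^ r * (a' * (x - x₂) ^ m + (-b ^ p - a') * (x - x₁) ^ m) = 0 := by rw [← h]; ring
      exact (mul_eq_zero.1 h2).resolve_left (pow_ne_zero _ hv)
    have F3 : (x - x₁) ^ m * ((x - x₂) ^ m * (b ^ p * (a' - a + b ^ p))) = 0 := by
      linear_combination (a' * (x - x₂) ^ m) * F1' +  (a - b ^ p) * (x - x₂) ^ m * F2' 
    have := (mul_eq_zero.1 F3).resolve_left (pow_ne_zero _ hu)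
    have := (mul_eq_zero.1 this).resolve_left (pow_ne_zero _ hv)
    have := (mul_eq_zero.1 this).resolve_left hbp
    linear_combination this
  have ha0 : a ≠ 0 := sub_ne_zero.2 hyn.symm
  have ha0' : a' ≠ 0 := sub_ne_zero.2 hzn.symm
  have R1 := formM_aux H.og₁ H.oh₁ m r hmr x₁ y₁ y₀ c b a ha hx11 E1 G1
  have R2 := formM_aux H.og₂ H.oh₂ m r hmr x₂ z₁ z₀ c (-b) a' ha' hx22 E2 G2
  refine ⟨x₁, b, a, hb0, ha0, fun h => ha0' (by rw [haa, h, sub_self]), R1.1, R1.2, ?_⟩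
  rw [hw', ← haa]
  exact R2

/-- both components are of type S -/
def IsS {K : Type*} [Field K] (p : ℕ) (g₁ h₁ g₂ h₂ : K[X]) : Prop :=
  ∃ (m : ℕ) (w α β α' β' : K), m ∣ p - 1 ∧ (m = 1 → w = 0) ∧ α ≠ 0 ∧ β ≠ 0 ∧ α' ≠ 0 ∧ β' ≠ 0 ∧
    h₁ = hS p m w β ∧ g₁ = gS p m w α β ∧ h₂ = hS p m w β' ∧ g₂ = gS p m w α' β'

/-- both components are of type M -/
def IsM {K : Type*} [Field K] (p : ℕ) (g₁ h₁ g₂ h₂ : K[X]) : Prop :=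
  ∃ (m : ℕ) (w b a : K), p < 2 * m ∧ m + 2 ≤ p ∧ b ≠ 0 ∧ a ≠ 0 ∧ a ≠ b ^ p ∧
    h₁ = hM p m w b a ∧ g₁ = gM p m w b a ∧
      h₂ = hM p m (w + b) (-b) (a - b ^ p) ∧ g₂ = gM p m (w + b) (-b) (a - b ^ p)

theorem Coll.class {g₁ h₁ g₂ h₂ : K[X]} (H : Coll p g₁ h₁ g₂ h₂) :
    IsS p g₁ h₁ g₂ h₂ ∨ IsM p g₁ h₁ g₂ h₂ := by
  classical
  have hp2 := (Fact.out : p.Prime).two_le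
  by_cases h0 : (derivative g₂).natDegree = 0
  · left
    have h0' := h0
    rw [← H.natDegree_eq.1] at h0'
    obtain ⟨α, β, hα, hβ, e1, e2⟩ := H.formA h0'
    obtain ⟨α', β', hα', hβ', e1', e2'⟩ := H.symm.formA h0
    exact ⟨1, 0, α, β, α', β', one_dvd _, fun _ => rfl, hα, hβ, hα', hβ', e1, e2, e1', e2'⟩
  · obtain ⟨z, hz⟩ : ∃ z, 1 < rami g₂ z := by
      rw [card_roots_derivative g₂ H.mg₂ H.dg₂ H.symm.sep_g₁] at h0
      obtain ⟨z, hz, hz'⟩ := Finset.exists_ne_zero_of_sum_ne_zero h0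
      exact ⟨z, by omega⟩
    have hdeg := H.natDegree_fibre z hz
    obtain ⟨m, r, y₀, hy₀, z₀, hz₀, hm, hr, hrm, hco, ry, rz, hY, hZ, hp, hc, hc1, hc2⟩ := H.fibre z hz
    set c := g₂.eval z with hcd
    have hyz : g₁.eval y₀ = g₂.eval z₀ := by
      rw [mem_fib g₁ H.dg₁] at hy₀
      rw [mem_fib g₂ H.dg₂] at hz₀
      rw [hy₀, hz₀]
    rcases Nat.lt_or_ge 1 r with hr1 | hr1
    · right
      have hcc := hc2 hr1
      have hcc' := hcc
      rw [hc] at hcc'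
      obtain ⟨y₁, hy₁, hyn⟩ := Finset.exists_mem_ne (by omega) y₀ (s := fib g₁ c)
      obtain ⟨z₁, hz₁, hzn⟩ := Finset.exists_mem_ne (by omega) z₀ (s := fib g₂ c)
      rw [hcc] at hp
      obtain ⟨w, b, a, h⟩ := H.formM m r c y₀ y₁ z₀ z₁ hr1 hrm (by omega) hy₀ hz₀ hy₁ hz₁ hyn hzn ry
        (hY _ hy₁ hyn) rz (hZ _ hz₁ hzn) (by
          intro y hy
          by_contra hcon
          push Not at hcon
          have : ({y₀, y₁, y} : Finset K) ⊆ fib g₁ c := by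
            intro t ht
            simp at ht
            rcases ht with rfl | rfl | rfl <;> assumption
          have := Finset.card_le_card this
          rw [Finset.card_eq_three.2 ⟨y₀, y₁, y, hyn.symm, hcon.1.symm, hcon.2.symm, rfl⟩] at this
          omega)
      exact ⟨m, w, b, a, by omega, by omega, h⟩
    · left
      have hr' : r = 1 := by omega
      subst hr'
      obtain ⟨w, hw1, hw2⟩ := H.exists_over y₀ z₀ hyz
      obtain ⟨l, hl⟩ : ∃ l, (fib g₁ c).card = l + 1 := ⟨_, (Nat.sub_add_cancel hc1.le).symm⟩
      have hl' := hl
      rw [hc] at hl'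
      rw [hl, Nat.add_sub_cancel] at hp
      have hml : m * l = p - 1 := by omega
      have hd2 : (derivative g₂).natDegree ≤ l * (m - 1) := by
        rw [Nat.mul_sub, mul_comm l m]; omega
      have hd1 := H.natDegree_eq.1.trans_le hd2
      obtain ⟨α, β, hα, hβ, e1, e2⟩ := H.formS m l c y₀ z₀ w hm (by omega) hml hy₀ hz₀ ry rz hY hZ hl hl' hw1 hw2 hd1
      obtain ⟨α', β', hα', hβ', e1', e2'⟩ := H.symm.formS m l c z₀ y₀ w hm (by omega) hml hz₀ hy₀ rz ry hZ hY hl' hl hw2 hw1 hd2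
      exact ⟨m, w, α, β, α', β', ⟨l, hml.symm⟩, fun h => by omega, hα, hβ, hα', hβ', e1, e2, e1', e2'⟩

end


open Polynomial

set_option linter.unusedSectionVars false
set_option linter.unusedSimpArgs false
set_option linter.deprecated false
set_option linter.unusedVariables false

section
variable {K : Type*} [Field K]

theorem monic_pow_inj {A B : K[X]} (hA : A.Monic) (hB : B.Monic) {n : ℕ} (hn : n ≠ 0) (h : A ^ n = B ^ n) : A = B := by
  apply eq_of_monic_of_associated hA hB
  apply associated_of_dvd_dvd
  · rw [← UniqueFactorizationMonoid.pow_dvd_pow_iff_dvd hn, h]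
  · rw [← UniqueFactorizationMonoid.pow_dvd_pow_iff_dvd hn, h]

theorem derivative_orig (P : K[X]) : derivative (orig P) = derivative P := by simp [orig]

theorem monic_pow_sub (l : ℕ) (hl : 0 < l) (w β : K) : ((X - C w) ^ l - C β).Monic := by
  apply ((monic_X_sub_C w).pow l).sub_of_left
  refine degree_C_le.trans_lt ?_
  rw [degree_pow, degree_X_sub_C]; simpa using hl

theorem natDegree_pow_sub (l : ℕ) (w β : K) : ((X - C w) ^ l - C β).natDegree = l := by
  rw [natDegree_sub_C, natDegree_pow, natDegree_X_sub_C, mul_one]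

theorem orig_eval (P : K[X]) : (orig P).eval 0 = 0 := by simp [orig]

end

section
variable {K : Type*} [Field K] {p : ℕ} [Fact p.Prime] [CharP K p]

theorem dvd_facts {m : ℕ} (h : m ∣ p - 1) : 0 < m ∧ 0 < (p - 1) / m ∧ m * ((p - 1) / m) = p - 1 := by
  have := (Fact.out : p.Prime).two_le
  have h0 : 0 < p - 1 := by omega
  exact ⟨Nat.pos_of_dvd_of_pos h h0, Nat.div_pos (Nat.le_of_dvd h0 h) (Nat.pos_of_dvd_of_pos h h0), Nat.mul_div_cancel' h⟩

theorem derivative_Sp (m : ℕ) (hm : m ∣ p - 1) (w β : K) :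
    derivative ((Sp p m β).comp (X - C w)) = C (-β) * ((X - C w) ^ ((p - 1) / m) - C β) ^ (m - 1) := by
  obtain ⟨h1, h2, h3⟩ := dvd_facts hm
  have hp2 := (Fact.out : p.Prime).two_le
  set l := (p - 1) / m with hl
  rw [Sp, ← hl]
  obtain ⟨k, rfl⟩ : ∃ k, m = k + 1 := ⟨m - 1, by omega⟩
  obtain ⟨j, hj⟩ : ∃ j, l = j + 1 := ⟨l - 1, by omega⟩
  rw [hj] at h3 ⊢
  have h4 : (((k + 1) * (j + 1) + 1 : ℕ) : K) = 0 := by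
    rw [h3, Nat.sub_add_cancel (by omega)]; exact CharP.cast_eq_zero K p
  have h5 := congrArg (C : K → K[X]) h4
  simp only [mul_comp, X_comp, pow_comp, sub_comp, C_comp, derivative_mul, derivative_sub, derivative_X,
    derivative_C, derivative_pow, Nat.add_sub_cancel]
  push_cast at h5 ⊢
  simp only [map_add, map_mul, map_one, map_zero, map_natCast, C_neg] at h5 ⊢
  linear_combination ((X - C w) ^ (j + 1) * ((X - C w) ^ (j + 1) - C β) ^ k) * h5

theorem derivative_hS (m : ℕ) (hm : m ∣ p - 1) (w β : K) :
    derivative (hS p m w β) = C (-β) * ((X - C w) ^ ((p - 1) / m) - C β) ^ (m - 1) := by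
  rw [hS, derivative_orig, derivative_Sp m hm]

theorem derivative_gS (m : ℕ) (hm : m ∣ p - 1) (w α β : K) :
    derivative (gS p m w α β) =
      C (-α) * ((X - C ((hS p m w β).eval w)) ^ ((p - 1) / m) - C α) ^ (m - 1) := by
  rw [gS, derivative_orig, derivative_Sp m hm]

theorem lc_S (m : ℕ) (hm : m ∣ p - 1) (w β : K) :
    (C (-β) * ((X - C w) ^ ((p - 1) / m) - C β) ^ (m - 1)).leadingCoeff = -β := by
  rw [leadingCoeff_mul, leadingCoeff_C, ((monic_pow_sub _ (dvd_facts hm).2.1 w β).pow _).leadingCoeff, mul_one]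

theorem deg_S (m : ℕ) (hm : m ∣ p - 1) (w β : K) (hβ : β ≠ 0) :
    (C (-β) * ((X - C w) ^ ((p - 1) / m) - C β) ^ (m - 1)).natDegree = p - 1 - (p - 1) / m := by
  rw [natDegree_C_mul (neg_ne_zero.2 hβ), natDegree_pow, natDegree_pow_sub, Nat.sub_mul, (dvd_facts hm).2.2, one_mul]

theorem hS_inj {m m' : ℕ} (hm : m ∣ p - 1) (hm' : m' ∣ p - 1) {w w' β β' : K} (hβ : β ≠ 0) (hβ' : β' ≠ 0)
    (hw : m = 1 → w = 0) (hw' : m' = 1 → w' = 0) (h : hS p m w β = hS p m' w' β') :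
    m = m' ∧ w = w' ∧ β = β' := by
  have hd := congrArg derivative h
  rw [derivative_hS m hm, derivative_hS m' hm'] at hd
  have hβe : β = β' := by
    have := congrArg leadingCoeff hd
    rw [lc_S m hm, lc_S m' hm'] at this
    exact neg_injective this
  subst hβe
  obtain ⟨h1, h2, h3⟩ := dvd_facts hm
  obtain ⟨h1', h2', h3'⟩ := dvd_facts hm'
  have hme : m = m' := by
    have := congrArg natDegree hd
    rw [deg_S m hm _ _ hβ, deg_S m' hm' _ _ hβ] at this
    have l1 := Nat.div_le_self (p - 1) m
    have l2 := Nat.div_le_self (p - 1) m'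
    have : (p - 1) / m = (p - 1) / m' := by omega
    rw [← this] at h3'
    exact Nat.eq_of_mul_eq_mul_right h2 (h3.trans h3'.symm)
  subst hme
  refine ⟨rfl, ?_, rfl⟩
  by_cases hm1 : m = 1
  · rw [hw hm1, hw' hm1]
  · have h4 := mul_left_cancel₀ (by simpa using hβ) hd
    have h5 := monic_pow_inj (monic_pow_sub _ h2 w β) (monic_pow_sub _ h2 w' β) (by omega) h4
    have h6 := congrArg (eval w) h5
    simp only [eval_sub, eval_pow, eval_X, eval_C, sub_self, zero_pow h2.ne', zero_sub] at h6
    have h7 : (w - w') ^ ((p - 1) / m) = 0 := by linear_combination -h6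
    exact sub_eq_zero.1 (pow_eq_zero_iff h2.ne' |>.1 h7)

theorem gS_inj {m : ℕ} (hm : m ∣ p - 1) {w α α' β : K} (h : gS p m w α β = gS p m w α' β) : α = α' := by
  have hd := congrArg derivative h
  rw [derivative_gS m hm, derivative_gS m hm] at hd
  have := congrArg leadingCoeff hd
  rw [lc_S m hm, lc_S m hm] at this
  exact neg_injective this

theorem derivative_hM (m : ℕ) (hm : p < 2 * m) (hm2 : m + 2 ≤ p) (w b a : K) :
    derivative (hM p m w b a) = C ((b ^ p)⁻¹ * (b ^ p - a) * (m * b)) * (X - C w) ^ (p - m - 1) * (X - C (w + b)) ^ (m - 1) := by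
  rw [hM, derivative_orig, hM0]
  obtain ⟨j, hj⟩ : ∃ j, p - m = j + 1 := ⟨p - m - 1, by omega⟩
  obtain ⟨k, rfl⟩ : ∃ k, m = k + 1 := ⟨m - 1, by omega⟩
  have h4 : (((j + 1) + (k + 1) : ℕ) : K) = 0 := by
    rw [show (j + 1) + (k + 1) = p by omega]; exact CharP.cast_eq_zero K p
  have h5 := congrArg (C : K → K[X]) h4
  have h6 : (C (p : K) : K[X]) = 0 := by rw [CharP.cast_eq_zero K p, C_0]
  rw [hj]
  simp only [derivative_mul, derivative_add, derivative_C, derivative_pow, derivative_sub, derivative_X,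
    Nat.add_sub_cancel, h6]
  push_cast at h5 ⊢
  simp only [map_add, map_mul, map_one, map_zero, map_natCast, map_sub] at h5 ⊢
  linear_combination (C (b ^ p)⁻¹ * (C (b ^ p) - C a) * (X - C w) ^ j * (X - (C w + C b)) ^ k * (X - C w - C b)) * h5

theorem rootMult_M [DecidableEq K] (k w v x : K) (hk : k ≠ 0) (i j : ℕ) :
    (C k * (X - C w) ^ i * (X - C v) ^ j).rootMultiplicity x =
      (if x = w then i else 0) + (if x = v then j else 0) := by
  have h0 : ∀ (y : K) (n : ℕ), (X - C y) ^ n ≠ 0 := fun y n => pow_ne_zero _ (X_sub_C_ne_zero y)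
  have hc : C k ≠ 0 := by simpa using hk
  have e : ∀ (y : K) (n : ℕ), ((X - C y) ^ n).rootMultiplicity x = if x = y then n else 0 := by
    intro y n
    split_ifs with h
    · rw [h, rootMultiplicity_X_sub_C_pow]
    · apply rootMultiplicity_eq_zero
      simp [sub_eq_zero, h]
  rw [rootMultiplicity_mul (mul_ne_zero (mul_ne_zero hc (h0 _ _)) (h0 _ _)), rootMultiplicity_mul (mul_ne_zero hc (h0 _ _)),
    rootMultiplicity_C, e, e, zero_add]

theorem kM_ne {m : ℕ} (hm : p < 2 * m) (hm2 : m + 2 ≤ p) {b a : K} (hb : b ≠ 0) (ha : a ≠ b ^ p) :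
    (b ^ p)⁻¹ * (b ^ p - a) * (m * b) ≠ 0 :=
  mul_ne_zero (mul_ne_zero (inv_ne_zero (pow_ne_zero _ hb)) (sub_ne_zero.2 ha.symm))
    (mul_ne_zero (natCast_ne_zero_of_lt (p := p) m (by omega) (by omega)) hb)

theorem hM0_eval₁ {m : ℕ} (hm2 : m + 2 ≤ p) (w b a : K) : (hM0 p m w b a).eval w = 0 := by
  have : p - m ≠ 0 := by omega
  have : p ≠ 0 := by omega
  simp [hM0, *]

theorem hM0_eval₂ {m : ℕ} (hm : p < 2 * m) (w b a : K) (hb : b ≠ 0) : (hM0 p m w b a).eval (w + b) = a := by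
  have : m ≠ 0 := by omega
  have := pow_ne_zero p hb
  simp [hM0, *]
  field_simp

theorem hM_eval_sub {m : ℕ} (hm : p < 2 * m) (hm2 : m + 2 ≤ p) (w b a : K) (hb : b ≠ 0) :
    (hM p m w b a).eval (w + b) - (hM p m w b a).eval w = a := by
  simp only [hM, orig, eval_sub, hM0_eval₁ hm2, hM0_eval₂ hm w b a hb, eval_C]
  ring

theorem hM_inj {m m' : ℕ} (hm : p < 2 * m) (hm2 : m + 2 ≤ p) (hm' : p < 2 * m') (hm2' : m' + 2 ≤ p)
    {w w' b b' a a' : K} (hb : b ≠ 0) (hb' : b' ≠ 0) (ha : a ≠ b ^ p) (ha' : a' ≠ b' ^ p)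
    (h : hM p m w b a = hM p m' w' b' a') : m = m' ∧ w = w' ∧ b = b' ∧ a = a' := by
  classical
  have hd := congrArg derivative h
  rw [derivative_hM m hm hm2, derivative_hM m' hm' hm2'] at hd
  have h1 := congrArg (rootMultiplicity w) hd
  have h2 := congrArg (rootMultiplicity (w + b)) hd
  rw [rootMult_M _ _ _ _ (kM_ne hm hm2 hb ha), rootMult_M _ _ _ _ (kM_ne hm' hm2' hb' ha')] at h1 h2
  have n1 : w ≠ w + b := by simpa using hb
  have n2 : w' ≠ w' + b' := by simpa using hb'
  rw [if_pos rfl, if_neg n1] at h1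
  rw [if_neg n1.symm, if_pos rfl] at h2
  have hww : w = w' := by
    by_contra hne
    rw [if_neg hne] at h1
    split_ifs at h1 <;> omega
  subst hww
  rw [if_pos rfl, if_neg n2] at h1
  have hme : m = m' := by omega
  subst hme
  have hwb : w + b = w + b' := by
    by_contra hne
    rw [if_neg hne, if_neg n1.symm] at h2
    omega
  have hbb : b = b' := add_left_cancel hwb
  subst hbb
  refine ⟨rfl, rfl, rfl, ?_⟩
  rw [← hM_eval_sub hm hm2 w b a hb, h, hM_eval_sub hm hm2 w b a' hb]

theorem hS_ne_hM {m m' : ℕ} (hm : m ∣ p - 1) (hm' : p < 2 * m') (hm2' : m' + 2 ≤ p) {w β w' b a : K}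
    (hβ : β ≠ 0) (hb : b ≠ 0) (ha : a ≠ b ^ p) : hS p m w β ≠ hM p m' w' b a := by
  classical
  intro h
  have hd := congrArg derivative h
  rw [derivative_hS m hm, derivative_hM m' hm' hm2'] at hd
  obtain ⟨h1, h2, h3⟩ := dvd_facts hm
  have hdeg := congrArg natDegree hd
  have hk := kM_ne hm' hm2' hb ha
  rw [deg_S m hm _ _ hβ, mul_assoc, natDegree_C_mul hk, natDegree_mul (pow_ne_zero _ (X_sub_C_ne_zero _)) (pow_ne_zero _ (X_sub_C_ne_zero _)),
    natDegree_pow, natDegree_pow, natDegree_X_sub_C, natDegree_X_sub_C] at hdeg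
  have hl : (p - 1) / m = 1 := by omega
  rw [hl, pow_one, sub_sub, ← C_add] at hd
  have e1 := congrArg (eval w') hd
  have e2 := congrArg (eval (w' + b)) hd
  have i1 : p - m' - 1 ≠ 0 := by omega
  have i2 : m' - 1 ≠ 0 := by omega
  rw [hl, mul_one] at h3
  have i3 : m - 1 ≠ 0 := by omega
  simp [i1, i2, i3, hβ] at e1 e2
  apply hb
  linear_combination e2 - e1

end

section
variable {K L : Type*} [Field K] [Field L] (σ : K →+* L)

theorem map_orig (P : K[X]) : (orig P).map σ = orig (P.map σ) := by
  simp only [orig, Polynomial.map_sub, map_C]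
  rw [← map_zero σ, eval_map_apply]

theorem map_Sp (p m : ℕ) (β : K) : (Sp p m β).map σ = Sp p m (σ β) := by
  simp [Sp]

theorem map_hS (p m : ℕ) (w β : K) : (hS p m w β).map σ = hS p m (σ w) (σ β) := by
  simp [hS, map_orig, map_Sp, Polynomial.map_comp]

theorem map_gS (p m : ℕ) (w α β : K) : (gS p m w α β).map σ = gS p m (σ w) (σ α) (σ β) := by
  simp [gS, map_orig, map_Sp, Polynomial.map_comp, ← map_hS, eval_map_apply]

theorem map_hM (p m : ℕ) (w b a : K) : (hM p m w b a).map σ = hM p m (σ w) (σ b) (σ a) := by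
  simp [hM, hM0, map_orig]

theorem map_gM (p m : ℕ) (w b a : K) : (gM p m w b a).map σ = gM p m (σ w) (σ b) (σ a) := by
  simp [gM, map_orig, ← map_hM, eval_map_apply]

end

section
variable {F : Type*} [Field F] [Finite F] {p : ℕ} [Fact p.Prime] [CharP F p]

theorem descend (x : AlgebraicClosure F) (h : ∀ σ : AlgebraicClosure F ≃ₐ[F] AlgebraicClosure F, σ x = x) :
    ∃ y : F, algebraMap F _ y = x := by
  have := (InfiniteGalois.mem_bot_iff_fixed (k := F) x).2 h
  exact this

theorem map_fix (P : F[X]) (σ : AlgebraicClosure F ≃ₐ[F] AlgebraicClosure F) :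
    (P.map (algebraMap F (AlgebraicClosure F))).map (σ : AlgebraicClosure F →+* AlgebraicClosure F) = P.map (algebraMap F _) := by
  rw [Polynomial.map_map]
  congr 1
  ext x
  simp

theorem Coll.map {K : Type*} [Field K] (f : F →+* K) {g₁ h₁ g₂ h₂ : F[X]} (H : Coll p g₁ h₁ g₂ h₂) :
    Coll p (g₁.map f) (h₁.map f) (g₂.map f) (h₂.map f) where
  mg₁ := H.mg₁.map f
  mh₁ := H.mh₁.map f
  mg₂ := H.mg₂.map f
  mh₂ := H.mh₂.map f
  dg₁ := by rw [natDegree_map, H.dg₁]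
  dh₁ := by rw [natDegree_map, H.dh₁]
  dg₂ := by rw [natDegree_map, H.dg₂]
  dh₂ := by rw [natDegree_map, H.dh₂]
  og₁ := by rw [← map_zero f, eval_map_apply, H.og₁]
  oh₁ := by rw [← map_zero f, eval_map_apply, H.oh₁]
  og₂ := by rw [← map_zero f, eval_map_apply, H.og₂]
  oh₂ := by rw [← map_zero f, eval_map_apply, H.oh₂]
  eq := by rw [← Polynomial.map_comp, H.eq, Polynomial.map_comp]
  ne := fun h => H.ne (map_injective f f.injective h)
  sep := by
    rw [← Polynomial.map_comp, derivative_map]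
    intro h
    exact H.sep ((Polynomial.map_eq_zero f).1 h)

theorem Coll.classF {g₁ h₁ g₂ h₂ : F[X]} (H : Coll p g₁ h₁ g₂ h₂) :
    IsS p g₁ h₁ g₂ h₂ ∨ IsM p g₁ h₁ g₂ h₂ := by
  have : CharP (AlgebraicClosure F) p := charP_of_injective_algebraMap (algebraMap F _).injective p
  have hinj := map_injective (algebraMap F (AlgebraicClosure F)) (algebraMap F (AlgebraicClosure F)).injective
  rcases (H.map (algebraMap F (AlgebraicClosure F))).class with h | h
  · left
    obtain ⟨m, w, α, β, α', β', hm, hw, hα, hβ, hα', hβ', e1, e2, e3, e4⟩ := h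
    have key : ∀ (g h : F[X]) (α β : AlgebraicClosure F), β ≠ 0 → h.map (algebraMap F _) = hS p m w β →
        g.map (algebraMap F _) = gS p m w α β → ∀ σ : AlgebraicClosure F ≃ₐ[F] AlgebraicClosure F, 
          σ w = w ∧ σ β = β ∧ σ α = α := by
      intro g h α β hβ e1 e2 σ
      have f1 := map_fix h σ
      have f2 := map_fix g σ
      rw [e1, map_hS] at f1
      rw [e2, map_gS] at f2
      obtain ⟨-, k1, k2⟩ := hS_inj (p := p) hm hm (by simpa using hβ) hβ (fun h => by simp [hw h]) hw f1
      rw [k1, k2] at f2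
      exact ⟨k1, k2, gS_inj (p := p) hm f2⟩
    have K1 := key g₁ h₁ α β hβ e1 e2
    have K2 := key g₂ h₂ α' β' hβ' e3 e4
    obtain ⟨w, rfl⟩ := descend w fun σ => (K1 σ).1
    obtain ⟨β, rfl⟩ := descend β fun σ => (K1 σ).2.1
    obtain ⟨α, rfl⟩ := descend α fun σ => (K1 σ).2.2
    obtain ⟨β', rfl⟩ := descend β' fun σ => (K2 σ).2.1
    obtain ⟨α', rfl⟩ := descend α' fun σ => (K2 σ).2.2
    simp only [← map_hS, ← map_gS, Ne, map_eq_zero] at *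
    exact ⟨m, w, α, β, α', β', hm, hw, hα, hβ, hα', hβ', hinj e1, hinj e2, hinj e3, hinj e4⟩
  · right
    obtain ⟨m, w, b, a, hm, hm2, hb, ha, ha2, e1, e2, e3, e4⟩ := h
    have key : ∀ σ : AlgebraicClosure F ≃ₐ[F] AlgebraicClosure F, σ w = w ∧ σ b = b ∧ σ a = a := by
      intro σ
      have f1 := map_fix h₁ σ
      rw [e1, map_hM] at f1
      exact (hM_inj (p := p) hm hm2 hm hm2 (by simpa using hb) hb (by
        intro h
        apply ha2
        have : σ a = σ (b ^ p) := by rw [map_pow]; exact h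
        exact σ.injective this) ha2 f1).2
    obtain ⟨w, rfl⟩ := descend w fun σ => (key σ).1
    obtain ⟨b, rfl⟩ := descend b fun σ => (key σ).2.1
    obtain ⟨a, rfl⟩ := descend a fun σ => (key σ).2.2
    simp only [← map_pow, ← map_sub, ← map_add, ← map_neg, ← map_hM, ← map_gM, Ne, map_eq_zero] at *
    exact ⟨m, w, b, a, hm, hm2, hb, ha, fun h => ha2 (by rw [h]), hinj e1, hinj e2, hinj e3, hinj e4⟩

end


open Polynomial

set_option linter.unusedSectionVars false
set_option linter.unusedSimpArgs false
set_option linter.deprecated false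
set_option linter.unusedVariables false

/-- monic original polynomials of degree `p` -/
structure MO {K : Type*} [Field K] (p : ℕ) (P : K[X]) : Prop where
  m : P.Monic
  d : P.natDegree = p
  o : P.eval 0 = 0

section
variable {K : Type*} [Field K] {p : ℕ} [Fact p.Prime] [CharP K p]

theorem MO_orig (P : K[X]) (hm : P.Monic) (hd : P.natDegree = p) : MO p (orig P) :=
  ⟨by
    have hp := (Fact.out : p.Prime).pos
    apply hm.sub_of_left
    refine lt_of_le_of_lt degree_C_le ?_
    rw [degree_eq_natDegree hm.ne_zero, hd]
    exact_mod_cast hp, by rw [orig, natDegree_sub_C, hd], orig_eval P⟩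

theorem Sp_comp (m : ℕ) (w β : K) : (Sp p m β).comp (X - C w) = (X - C w) * ((X - C w) ^ ((p - 1) / m) - C β) ^ m := by
  simp [Sp]

theorem MO_S {m : ℕ} (hm : m ∣ p - 1) (w β : K) : MO p (orig ((Sp p m β).comp (X - C w))) := by
  obtain ⟨h1, h2, h3⟩ := dvd_facts hm
  have hp2 := (Fact.out : p.Prime).two_le
  have hmon := (monic_pow_sub _ h2 w β).pow m
  apply MO_orig
  · rw [Sp_comp]
    exact (monic_X_sub_C w).mul hmon
  · rw [Sp_comp, (monic_X_sub_C w).natDegree_mul hmon, natDegree_X_sub_C, natDegree_pow, natDegree_pow_sub, h3]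
    omega

theorem MO_hS {m : ℕ} (hm : m ∣ p - 1) (w β : K) : MO p (hS p m w β) := MO_S hm w β

theorem MO_gS {m : ℕ} (hm : m ∣ p - 1) (w α β : K) : MO p (gS p m w α β) := MO_S hm _ α

theorem hM0_monic {m : ℕ} (hm2 : m + 2 ≤ p) (w b a : K) (hb : b ≠ 0) :
    (hM0 p m w b a).Monic ∧ (hM0 p m w b a).natDegree = p := by
  have hbp := pow_ne_zero p hb
  have hCb : C (b ^ p)⁻¹ * C (b ^ p) = (1 : K[X]) := by rw [← C_mul, inv_mul_cancel₀ hbp, C_1]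
  set r := p - m with hr
  have hmr : r + m = p := by omega
  have hmonQ : hM0 p m w b a = (X - C w : K[X]) ^ p + C ((b ^ p)⁻¹ * (b ^ p - a)) * ((X - C w) ^ r * (X - C (w + b)) ^ m - (X - C w) ^ p) := by
    rw [hM0, ← hr, C_sub, C_mul, C_sub]
    linear_combination ((X - C w)^p) * hCb
  have hd1 : ((X - C w : K[X]) ^ r * (X - C (w + b)) ^ m).degree = (p : WithBot ℕ) := by
    rw [degree_mul, degree_pow, degree_pow, degree_X_sub_C, degree_X_sub_C, ← hmr]; simp
  have hd2 : ((X - C w : K[X]) ^ p).degree = (p : WithBot ℕ) := by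
    rw [degree_pow, degree_X_sub_C]; simp
  have hm1 : ((X - C w : K[X]) ^ r * (X - C (w + b)) ^ m).Monic := ((monic_X_sub_C _).pow _).mul ((monic_X_sub_C _).pow _)
  have hm2 : ((X - C w : K[X]) ^ p).Monic := (monic_X_sub_C _).pow _
  have l1 : ((X - C w : K[X]) ^ r * (X - C (w + b)) ^ m - (X - C w) ^ p).degree < (p : WithBot ℕ) := by
    rw [← hd1]
    exact degree_sub_lt (hd1.trans hd2.symm) hm1.ne_zero (by rw [hm1.leadingCoeff, hm2.leadingCoeff])
  have l3 : (C ((b ^ p)⁻¹ * (b ^ p - a)) * ((X - C w : K[X]) ^ r * (X - C (w + b)) ^ m - (X - C w) ^ p)).degree < ((X - C w : K[X]) ^ p).degree := by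
    rw [hd2]
    exact lt_of_le_of_lt (by rw [C_mul']; exact degree_smul_le _ _) l1
  rw [hmonQ]
  refine ⟨hm2.add_of_left l3, ?_⟩
  rw [natDegree_add_eq_left_of_degree_lt l3, natDegree_pow, natDegree_X_sub_C, mul_one]

theorem MO_hM {m : ℕ} (hm2 : m + 2 ≤ p) (w b a : K) (hb : b ≠ 0) : MO p (hM p m w b a) :=
  MO_orig _ (hM0_monic hm2 w b a hb).1 (hM0_monic hm2 w b a hb).2

theorem MO_gM {m : ℕ} (hm2 : m + 2 ≤ p) (w b a : K) : MO p (gM p m w b a) := by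
  apply MO_orig
  · exact ((monic_X_sub_C _).pow _).mul ((monic_X_sub_C _).pow _)
  · rw [((monic_X_sub_C _).pow _).natDegree_mul ((monic_X_sub_C _).pow _), natDegree_pow, natDegree_pow,
      natDegree_X_sub_C, natDegree_X_sub_C]
    omega

theorem orig_comp (P h : K[X]) (h0 : h.eval 0 = 0) : (orig P).comp h = orig (P.comp h) := by
  simp [orig, eval_comp, h0]

theorem orig_sub_eval (P : K[X]) (w : K) (h : P.eval w = 0) : orig P - C ((orig P).eval w) = P := by
  simp [orig, h]

noncomputable def SS (p m : ℕ) (α β : K) : K[X] :=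
  X * (X ^ ((p - 1) / m * (p + 1)) - C (β ^ p + α) * X ^ ((p - 1) / m) + C (α * β)) ^ m

theorem Sp_Sp {m : ℕ} (hm : m ∣ p - 1) (α β : K) : (Sp p m α).comp (Sp p m β) = SS p m α β := by
  obtain ⟨h1, h2, h3⟩ := dvd_facts hm
  have hp2 := (Fact.out : p.Prime).two_le
  simp only [Sp, SS, mul_comp, X_comp, pow_comp, sub_comp, C_comp]
  set l := (p - 1) / m
  rw [mul_assoc, ← mul_pow, mul_pow X, ← pow_mul (X ^ l - C β), h3]
  congr 2
  have hB : (X ^ l - C β : K[X]) * (X ^ l - C β) ^ (p - 1) = (X ^ l) ^ p - C β ^ p := by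
    rw [← pow_succ', Nat.sub_add_cancel (by omega), sub_pow_char]
  have hX : (X : K[X]) ^ (l * (p + 1)) = X ^ l * (X ^ l) ^ p := by
    rw [← pow_mul, ← pow_add]; congr 1; ring
  rw [hX]
  simp only [C_add, C_mul, C_pow]
  linear_combination X ^ l * hB

theorem comp_S {m : ℕ} (hm : m ∣ p - 1) (w α β : K) :
    (gS p m w α β).comp (hS p m w β) = orig ((SS p m α β).comp (X - C w)) := by
  rw [gS, orig_comp _ _ (MO_hS hm w β).o]
  congr 1
  rw [comp_assoc, ← Sp_Sp hm, comp_assoc]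
  congr 1
  have := orig_sub_eval ((Sp p m β).comp (X - C w)) w (by simp [Sp])
  rw [sub_comp, X_comp, C_comp]
  exact this

theorem orig_inj_of {P Q : K[X]} (w : K) (hP : P.eval 0 = 0) (hQ : Q.eval 0 = 0)
    (h : orig (P.comp (X - C w)) = orig (Q.comp (X - C w))) : P = Q := by
  have h1 := congrArg (fun R => R.comp (X + C w)) h
  simp only [orig, sub_comp, C_comp, comp_assoc, X_comp, add_sub_cancel_right, comp_X] at h1
  have h2 := congrArg (eval 0) h1
  simp only [eval_sub, hP, hQ, eval_C, zero_sub, neg_inj] at h2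
  rw [h2] at h1
  exact sub_left_injective h1

theorem SS_eq {m : ℕ} (hm : m ∣ p - 1) (α β α' β' : K) :
    SS p m α β = SS p m α' β' ↔ β' ^ p + α' = β ^ p + α ∧ α' * β' = α * β := by
  obtain ⟨h1, h2, h3⟩ := dvd_facts hm
  have hp2 := (Fact.out : p.Prime).two_le
  constructor
  · intro h
    have h4 := mul_left_cancel₀ X_ne_zero h
    have hmon : ∀ s t : K, (X ^ ((p - 1) / m * (p + 1)) - C s * X ^ ((p - 1) / m) + C t).Monic := by
      intro s t
      rw [sub_add]
      apply (monic_X_pow _).sub_of_left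
      rw [degree_X_pow]
      refine lt_of_le_of_lt (degree_sub_le _ _) (max_lt ?_ ?_)
      · refine lt_of_le_of_lt (degree_C_mul_X_pow_le _ _) ?_
        norm_cast
        nlinarith
      · refine lt_of_le_of_lt degree_C_le ?_
        norm_cast
        positivity
    have h5 := monic_pow_inj (hmon _ _) (hmon _ _) h1.ne' h4
    have n1 : (p - 1) / m ≠ (p - 1) / m * (p + 1) := by nlinarith
    have n0 : 0 ≠ (p - 1) / m * (p + 1) := by positivity
    constructor
    · have := congrArg (fun P => P.coeff ((p - 1) / m)) h5
      simp only [coeff_add, coeff_sub, coeff_X_pow, coeff_C_mul, coeff_C, if_neg n1, if_neg h2.ne', if_pos] at this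
      linear_combination this
    · have := congrArg (fun P => P.coeff 0) h5
      simp only [coeff_add, coeff_sub, coeff_X_pow, coeff_C_mul, coeff_C, if_neg n0, if_neg h2.ne, if_pos] at this
      linear_combination -this
  · rintro ⟨e1, e2⟩
    rw [SS, SS, e1, e2]

theorem comp_S_eq {m : ℕ} (hm : m ∣ p - 1) (w α β α' β' : K) :
    (gS p m w α' β').comp (hS p m w β') = (gS p m w α β).comp (hS p m w β) ↔
      β' ^ p + α' = β ^ p + α ∧ α' * β' = α * β := by
  rw [comp_S hm, comp_S hm, ← SS_eq hm]
  constructor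
  · intro h
    exact (orig_inj_of w (by simp [SS]) (by simp [SS]) h).symm
  · intro h; rw [h]

theorem neg_pow_p (b : K) : (-b) ^ p = - b ^ p := by
  have := (Fact.out : p.Prime)
  rcases this.eq_two_or_odd' with h | h
  · have h2 : (2 : K) = 0 := by
      have := CharP.cast_eq_zero K p
      rw [h] at this; exact_mod_cast this
    rw [h]
    linear_combination b ^ 2 * h2
  · exact h.neg_pow b

theorem hM_facts {m : ℕ} (hm : p < 2 * m) (hm2 : m + 2 ≤ p) (w b a : K) (hb : b ≠ 0) :
    hM p m w b a - C ((hM p m w b a).eval w) = C (b ^ p)⁻¹ * ((X - C w) ^ (p - m) * (C a * (X - C w) ^ m + C (b ^ p - a) * (X - C (w + b)) ^ m)) ∧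
    hM p m w b a - C ((hM p m w b a).eval w + a) = C (b ^ p)⁻¹ * ((X - C (w + b)) ^ m * (C a * (X - C (w + b)) ^ (p - m) + C (b ^ p - a) * (X - C w) ^ (p - m))) := by
  have hbp := pow_ne_zero p hb
  have hCb : C (b ^ p)⁻¹ * C (b ^ p) = (1 : K[X]) := by rw [← C_mul, inv_mul_cancel₀ hbp, C_1]
  have e := orig_sub_eval (hM0 p m w b a) w (hM0_eval₁ hm2 w b a)
  have hp : ∀ u : K[X], u ^ p = u ^ (p - m) * u ^ m := fun u => by rw [← pow_add, Nat.sub_add_cancel (by omega)]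
  have hv : (X - C (w + b) : K[X]) ^ p = (X - C w) ^ p - C (b ^ p) := by
    rw [C_pow, ← sub_pow_char (p := p)]
    congr 1
    simp; ring
  change hM p m w b a - C ((hM p m w b a).eval w) = _ at e
  refine ⟨?_, ?_⟩
  · rw [e, hM0]
    linear_combination C (b ^ p)⁻¹ * C a * hp (X - C w)
  · rw [C_add, ← sub_sub, e, hM0]
    linear_combination C (b ^ p)⁻¹ * C a * hp (X - C (w + b)) + C a * hCb - C (b ^ p)⁻¹ * C a * hv

theorem comp_M {m : ℕ} (hm : p < 2 * m) (hm2 : m + 2 ≤ p) (w b a : K) (hb : b ≠ 0) :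
    (gM p m (w + b) (-b) (a - b ^ p)).comp (hM p m (w + b) (-b) (a - b ^ p)) =
      (gM p m w b a).comp (hM p m w b a) := by
  rw [gM, gM, orig_comp _ _ (MO_hM hm2 w b a hb).o, orig_comp _ _ (MO_hM hm2 _ _ _ (neg_ne_zero.2 hb)).o]
  refine congrArg orig ?_
  obtain ⟨e1, e2⟩ := hM_facts hm hm2 w b a hb
  obtain ⟨f1, f2⟩ := hM_facts hm hm2 (w + b) (-b) (a - b ^ p) (neg_ne_zero.2 hb)
  simp only [mul_comp, pow_comp, sub_comp, X_comp, C_comp]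
  rw [e1, e2, f1, f2, neg_pow_p, add_neg_cancel_right, show -b ^ p - (a - b ^ p) = -a by ring,
    inv_neg, C_neg, C_neg, show a - b ^ p = -(b ^ p - a) by ring, C_neg]
  generalize (X - C w : K[X]) = u
  generalize (X - C (w + b) : K[X]) = v
  generalize (C (b ^ p)⁻¹ : K[X]) = k
  generalize (C (b ^ p - a) : K[X]) = c
  generalize (C a : K[X]) = d
  generalize p - m = r
  have h1 : -k * (v ^ r * (-c * v ^ m + -d * u ^ m)) = k * v ^ r * (d * u ^ m + c * v ^ m) := by ring
  have h2 : -k * (u ^ m * (-c * u ^ r + -d * v ^ r)) = k * u ^ m * (d * v ^ r + c * u ^ r) := by ring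
  rw [h1, h2, ← mul_assoc k, ← mul_assoc k]
  generalize d * u ^ m + c * v ^ m = A
  generalize d * v ^ r + c * u ^ r = B
  simp only [mul_pow, ← pow_mul, mul_comm m r]
  ring

end


open Polynomial

set_option linter.unusedSectionVars false
set_option linter.unusedSimpArgs false
set_option linter.deprecated false
set_option linter.unusedVariables false

section
variable {F : Type*} [Field F] [Fintype F] [DecidableEq F] {p : ℕ} [Fact p.Prime] [CharP F p]

/-- the additive map `s ↦ α s^p - β s` -/
def addMap (p : ℕ) [Fact p.Prime] [CharP F p] (α β : F) : F →+ F where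
  toFun s := α * s ^ p - β * s
  map_zero' := by simp [(Fact.out : p.Prime).ne_zero]
  map_add' x y := by rw [add_pow_char]; ring

def Jset (p : ℕ) (α β : F) : Finset F := Finset.univ.filter fun s => α * s ^ p - β * s = 1
def Kset (p : ℕ) (α β : F) : Finset F := Finset.univ.filter fun s => s ≠ 0 ∧ α * s ^ p = β * s
def Rset (p : ℕ) (α β : F) : Finset (F × F) :=
  Finset.univ.filter fun x => x.1 ≠ 0 ∧ x.2 ≠ 0 ∧ x.2 ^ p + x.1 = β ^ p + α ∧ x.1 * x.2 = α * β

theorem card_R {α β : F} (hα : α ≠ 0) (hβ : β ≠ 0) : (Rset p α β).card = 1 + (Jset p α β).card := by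
  have hp := (Fact.out : p.Prime).ne_zero
  have hmem : (α, β) ∈ Rset p α β := by simp [Rset, hα, hβ]
  rw [← Finset.card_erase_add_one hmem, add_comm]
  congr 1
  refine Finset.card_bij' (fun x _ => (x.2 - β)⁻¹) (fun s _ => (β * s / s ^ p, β + s⁻¹)) ?_ ?_ ?_ ?_
  · rintro ⟨a, b⟩ h
    simp only [Rset, Jset, Finset.mem_erase, Finset.mem_filter, Finset.mem_univ, true_and, ne_eq, Prod.mk.injEq] at h ⊢
    obtain ⟨hne, ha, hb, e1, e2⟩ := h
    have hs : b - β ≠ 0 := by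
      intro h0
      have : b = β := sub_eq_zero.1 h0
      subst this
      exact hne ⟨mul_right_cancel₀ hb e2, rfl⟩
    have e3 : (b - β) ^ p = α - a := by rw [sub_pow_char]; linear_combination e1
    have e4 : α - a ≠ 0 := by rw [← e3]; exact pow_ne_zero _ hs
    rw [inv_pow, e3]
    field_simp
    linear_combination e2
  · intro s h
    simp only [Rset, Jset, Finset.mem_erase, Finset.mem_filter, Finset.mem_univ, true_and, ne_eq, Prod.mk.injEq] at h ⊢
    have hs : s ≠ 0 := by rintro rfl; simp [hp] at h
    have hsp := pow_ne_zero p hs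
    refine ⟨fun h0 => ?_, ?_, ?_, ?_, ?_⟩
    · have := h0.2
      simp [hs] at this
    · exact div_ne_zero (mul_ne_zero hβ hs) hsp
    · intro h0
      have : β * s = - 1 := by field_simp at h0; linear_combination h0
      have h1 : α * s ^ p = 0 := by linear_combination h + this
      exact mul_ne_zero hα hsp h1
    · rw [add_pow_char, inv_pow]
      field_simp
      linear_combination -h
    · field_simp
      linear_combination -h
  · rintro ⟨a, b⟩ h
    simp only [Rset, Finset.mem_erase, Finset.mem_filter, Finset.mem_univ, true_and, ne_eq, Prod.mk.injEq] at h ⊢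
    obtain ⟨hne, ha, hb, e1, e2⟩ := h
    have hs : b - β ≠ 0 := by
      intro h0
      have : b = β := sub_eq_zero.1 h0
      subst this
      exact hne ⟨mul_right_cancel₀ hb e2, rfl⟩
    have e3 : (b - β) ^ p = α - a := by rw [sub_pow_char]; linear_combination e1
    have e4 : α - a ≠ 0 := by rw [← e3]; exact pow_ne_zero _ hs
    constructor
    · rw [inv_pow, e3]
      field_simp
      linear_combination -e2
    · simp
  · intro s h
    simp

theorem JK {α β : F} (hα : α ≠ 0) (hβ : β ≠ 0) :
    ((Kset p α β).card = 0 ∧ (Jset p α β).card = 1) ∨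
    ((Kset p α β).card = p - 1 ∧ (Jset p α β).card = 0) ∨
    ((Kset p α β).card = p - 1 ∧ (Jset p α β).card = p) := by
  have hp := (Fact.out : p.Prime)
  by_cases hK : Kset p α β = ∅
  · left
    refine ⟨by rw [hK]; rfl, ?_⟩
    have hinj : Function.Injective (addMap p α β) := by
      rw [injective_iff_map_eq_zero]
      intro s hs
      by_contra h0
      have : s ∈ Kset p α β := by
        simp only [Kset, Finset.mem_filter, Finset.mem_univ, true_and]
        exact ⟨h0, sub_eq_zero.1 hs⟩
      rw [hK] at this; simp at this
    obtain ⟨s, hs⟩ := (Finite.injective_iff_surjective.1 hinj) 1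
    rw [Finset.card_eq_one]
    refine ⟨s, ?_⟩
    ext t
    simp only [Jset, Finset.mem_filter, Finset.mem_univ, true_and, Finset.mem_singleton]
    constructor
    · intro h; exact hinj (Eq.trans h hs.symm)
    · rintro rfl; exact hs
  · right
    obtain ⟨s₀, hs₀⟩ := Finset.nonempty_iff_ne_empty.2 hK
    have hN : (Finset.univ.filter fun s : F => addMap p α β s = 0) = insert 0 (Kset p α β) := by
      ext s
      simp only [Kset, Finset.mem_filter, Finset.mem_univ, true_and, Finset.mem_insert]
      constructor
      · intro h
        by_cases h0 : s = 0
        · exact Or.inl h0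
        · exact Or.inr ⟨h0, sub_eq_zero.1 h⟩
      · rintro (rfl | ⟨_, h⟩)
        · simp
        · exact sub_eq_zero.2 h
    have h0K : (0 : F) ∉ Kset p α β := by simp [Kset]
    have hNc : (Finset.univ.filter fun s : F => addMap p α β s = 0).card = p := by
      apply le_antisymm
      · have hP : (C α * X ^ p - C β * X : F[X]).natDegree = p := by
          rw [natDegree_sub_eq_left_of_natDegree_lt, natDegree_C_mul_X_pow _ _ hα]
          rw [natDegree_C_mul_X_pow _ _ hα, natDegree_C_mul_X _ hβ]
          exact hp.one_lt
        have hP0 : (C α * X ^ p - C β * X : F[X]) ≠ 0 := by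
          intro h; rw [h] at hP; simp at hP; exact hp.ne_zero hP.symm
        have hsub : (Finset.univ.filter fun s : F => addMap p α β s = 0) ⊆ (C α * X ^ p - C β * X : F[X]).roots.toFinset := by
          intro s hs
          rw [Multiset.mem_toFinset, mem_roots hP0]
          simp only [Finset.mem_filter] at hs
          have h5 : α * s ^ p - β * s = 0 := hs.2
          simpa using h5
        calc _ ≤ _ := Finset.card_le_card hsub
          _ ≤ _ := Multiset.toFinset_card_le _
          _ ≤ _ := card_roots' _
          _ = p := hP
      · have hcard : Nat.card (addMap p α β).ker = (Finset.univ.filter fun s : F => addMap p α β s = 0).card := by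
          rw [Nat.card_eq_fintype_card, Fintype.card_subtype]
          congr 1
          ext x
          simp only [Finset.mem_filter, Finset.mem_univ, true_and]
          exact Iff.rfl
        rw [← hcard]
        simp only [Kset, Finset.mem_filter, Finset.mem_univ, true_and] at hs₀
        have hmem : s₀ ∈ (addMap p α β).ker := sub_eq_zero.2 hs₀.2
        have ho : addOrderOf (⟨s₀, hmem⟩ : (addMap p α β).ker) = p := by
          apply addOrderOf_eq_prime
          · apply Subtype.ext
            change p • s₀ = 0
            rw [nsmul_eq_mul, CharP.cast_eq_zero, zero_mul]
          · intro h; exact hs₀.1 (congrArg Subtype.val h)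
        apply Nat.le_of_dvd Nat.card_pos
        conv_lhs => rw [← ho]
        exact addOrderOf_dvd_natCard _
    have hKc : (Kset p α β).card = p - 1 := by
      rw [hN, Finset.card_insert_of_notMem h0K] at hNc
      omega
    by_cases hJ : Jset p α β = ∅
    · left; exact ⟨hKc, by rw [hJ]; rfl⟩
    · right
      refine ⟨hKc, ?_⟩
      obtain ⟨t, ht⟩ := Finset.nonempty_iff_ne_empty.2 hJ
      have ht' : addMap p α β t = 1 := by
        simp only [Jset, Finset.mem_filter, Finset.mem_univ, true_and] at ht
        exact ht
      conv_rhs => rw [← hNc]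
      refine Finset.card_bij' (fun x _ => x - t) (fun x _ => x + t) ?_ ?_ ?_ ?_
      · intro s hs
        simp only [Jset, Finset.mem_filter, Finset.mem_univ, true_and] at hs ⊢
        have hs : addMap p α β s = 1 := hs
        rw [map_sub, hs, ht', sub_self]
      · intro s hs
        simp only [Jset, Finset.mem_filter, Finset.mem_univ, true_and] at hs ⊢
        change addMap p α β (s + t) = 1
        rw [map_add, hs, ht', zero_add]
      · intro s _; simp
      · intro s _; simp

theorem JK_formula {α β : F} (hα : α ≠ 0) (hβ : β ≠ 0) :
    (1 : ℚ) - 1 / ((Rset p α β).card : ℚ) =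
      ((p : ℚ) - 1) / (2 * (p + 1)) + (Jset p α β).card / (p + 1) - (Kset p α β).card / (2 * (p + 1)) := by
  have hp := (Fact.out : p.Prime)
  have h1 : ((p - 1 : ℕ) : ℚ) = p - 1 := by rw [Nat.cast_sub hp.one_lt.le]; simp
  have hp0 : (p : ℚ) + 1 ≠ 0 := by positivity
  have hp0' : 1 + (p : ℚ) ≠ 0 := by positivity
  rw [card_R hα hβ]
  rcases JK (p := p) hα hβ with ⟨a, b⟩ | ⟨a, b⟩ | ⟨a, b⟩ <;> rw [a, b] <;> push_cast [h1] <;> field_simp <;> ring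

def Nz (F : Type*) [Field F] [Fintype F] [DecidableEq F] : Finset F := Finset.univ.erase 0

theorem card_Nz : ((Nz F).card : ℚ) = (Fintype.card F : ℚ) - 1 := by
  rw [Nz, Finset.card_erase_of_mem (Finset.mem_univ _), Finset.card_univ, Nat.cast_sub Fintype.card_pos]
  simp

theorem sum_J : ∑ x ∈ Nz F ×ˢ Nz F, ((Jset p x.1 x.2).card : ℚ) = ((Fintype.card F : ℚ) - 1) * (Fintype.card F - 2) := by
  have hp := (Fact.out : p.Prime)
  have h1 : ∀ x : F × F, ((Jset p x.1 x.2).card : ℚ) = ∑ s ∈ Nz F, if x.1 * s ^ p - x.2 * s = 1 then (1 : ℚ) else 0 := by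
    intro x
    rw [Finset.sum_boole]
    congr 2
    ext s
    simp only [Jset, Nz, Finset.mem_filter, Finset.mem_univ, true_and, Finset.mem_erase, and_true]
    constructor
    · intro h
      refine ⟨?_, h⟩
      rintro rfl; simp [hp.ne_zero] at h
    · exact fun h => h.2
  simp_rw [h1]
  rw [Finset.sum_comm]
  have h2 : ∀ s ∈ Nz F, ∑ x ∈ Nz F ×ˢ Nz F, (if x.1 * s ^ p - x.2 * s = 1 then (1 : ℚ) else 0) = (Fintype.card F : ℚ) - 2 := by
    intro s hs
    have hs0 : s ≠ 0 := by simpa [Nz] using hs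
    have hsp := pow_ne_zero p hs0
    rw [Finset.sum_boole]
    have : ((Nz F ×ˢ Nz F).filter fun x => x.1 * s ^ p - x.2 * s = 1).card = ((Nz F).erase (s ^ p)⁻¹).card := by
      refine Finset.card_bij' (fun x _ => x.1) (fun a _ => (a, (a * s ^ p - 1) / s)) ?_ ?_ ?_ ?_
      · rintro ⟨a, b⟩ h
        simp only [Nz, Finset.mem_filter, Finset.mem_product, Finset.mem_erase, Finset.mem_univ, and_true] at h ⊢
        refine ⟨?_, h.1.1⟩
        rintro rfl
        rw [inv_mul_cancel₀ hsp] at h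
        have : b * s = 0 := by linear_combination -h.2
        exact mul_ne_zero h.1.2 hs0 this
      · intro a h
        simp only [Nz, Finset.mem_filter, Finset.mem_product, Finset.mem_erase, Finset.mem_univ, and_true] at h ⊢
        refine ⟨⟨h.2, div_ne_zero ?_ hs0⟩, ?_⟩
        · intro h0
          apply h.1
          apply eq_inv_of_mul_eq_one_left
          linear_combination h0
        · field_simp; ring
      · rintro ⟨a, b⟩ h
        simp only [Nz, Finset.mem_filter, Finset.mem_product, Finset.mem_erase, Finset.mem_univ, and_true] at h ⊢
        rw [Prod.mk.injEq]
        refine ⟨rfl, ?_⟩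
        field_simp
        linear_combination h.2
      · intro a h; rfl
    rw [this]
    have hmem : (s ^ p)⁻¹ ∈ Nz F := by simp [Nz, hs0]
    have := Finset.card_erase_add_one hmem
    have h4 := card_Nz (F := F)
    rw [← this] at h4
    push_cast at h4
    linear_combination h4
  rw [Finset.sum_congr rfl h2, Finset.sum_const, nsmul_eq_mul, card_Nz]

theorem sum_K : ∑ x ∈ Nz F ×ˢ Nz F, ((Kset p x.1 x.2).card : ℚ) = ((Fintype.card F : ℚ) - 1) ^ 2 := by
  have hp := (Fact.out : p.Prime)
  have h1 : ∀ x : F × F, ((Kset p x.1 x.2).card : ℚ) = ∑ s ∈ Nz F, if x.1 * s ^ p = x.2 * s then (1 : ℚ) else 0 := by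
    intro x
    rw [Finset.sum_boole]
    congr 2
    ext s
    simp [Kset, Nz]
  simp_rw [h1]
  rw [Finset.sum_comm]
  have h2 : ∀ s ∈ Nz F, ∑ x ∈ Nz F ×ˢ Nz F, (if x.1 * s ^ p = x.2 * s then (1 : ℚ) else 0) = (Fintype.card F : ℚ) - 1 := by
    intro s hs
    have hs0 : s ≠ 0 := by simpa [Nz] using hs
    have hsp := pow_ne_zero p hs0
    rw [Finset.sum_boole, ← card_Nz]
    congr 1
    refine Finset.card_bij' (fun x _ => x.1) (fun a _ => (a, (a * s ^ p) / s)) ?_ ?_ ?_ ?_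
    · rintro ⟨a, b⟩ h
      simp only [Nz, Finset.mem_filter, Finset.mem_product, Finset.mem_erase, Finset.mem_univ, and_true] at h ⊢
      exact h.1.1
    · intro a h
      simp only [Nz, Finset.mem_filter, Finset.mem_product, Finset.mem_erase, Finset.mem_univ, and_true] at h ⊢
      refine ⟨⟨h, div_ne_zero (mul_ne_zero h hsp) hs0⟩, ?_⟩
      field_simp
    · rintro ⟨a, b⟩ h
      simp only [Nz, Finset.mem_filter, Finset.mem_product, Finset.mem_erase, Finset.mem_univ, and_true] at h ⊢
      rw [Prod.mk.injEq]
      refine ⟨rfl, ?_⟩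
      field_simp
      linear_combination h.2
    · intro a h; rfl
  rw [Finset.sum_congr rfl h2, Finset.sum_const, nsmul_eq_mul, card_Nz]
  ring

theorem sum_R : ∑ x ∈ Nz F ×ˢ Nz F, ((1 : ℚ) - 1 / ((Rset p x.1 x.2).card : ℚ)) =
    ((Fintype.card F : ℚ) - 1) * (Fintype.card F * p - p - 2) / (2 * (p + 1)) := by
  have hp0 : (p : ℚ) + 1 ≠ 0 := by positivity
  have : ∀ x ∈ Nz F ×ˢ Nz F, ((1 : ℚ) - 1 / ((Rset p x.1 x.2).card : ℚ)) =
      ((p : ℚ) - 1) / (2 * (p + 1)) + (Jset p x.1 x.2).card / (p + 1) - (Kset p x.1 x.2).card / (2 * (p + 1)) := by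
    intro x hx
    simp only [Nz, Finset.mem_product, Finset.mem_erase, Finset.mem_univ, and_true] at hx
    exact JK_formula hx.1 hx.2
  rw [Finset.sum_congr rfl this, Finset.sum_sub_distrib, Finset.sum_add_distrib, ← Finset.sum_div, ← Finset.sum_div, ← Finset.sum_div,
    sum_J, sum_K, Finset.sum_const, nsmul_eq_mul, Finset.card_product]
  push_cast
  rw [card_Nz]
  field_simp
  ring

end


open Polynomial

set_option linter.unusedSectionVars false
set_option linter.unusedSimpArgs false
set_option linter.deprecated false
set_option linter.unusedVariables false

section

theorem card_image_fib {ι κ : Type*} [DecidableEq κ] (D : Finset ι) (f : ι → κ) :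
    ((D.image f).card : ℚ) = D.card - ∑ d ∈ D, ((1 : ℚ) - 1 / ((D.filter fun e => f e = f d).card : ℚ)) := by
  have h : ∑ d ∈ D, (1 : ℚ) / ((D.filter fun e => f e = f d).card : ℚ) = (D.image f).card := by
    rw [← Finset.sum_fiberwise_of_maps_to (s := D) (t := D.image f) (g := f) (fun i hi => Finset.mem_image_of_mem f hi)]
    rw [Finset.card_eq_sum_ones]
    push_cast
    apply Finset.sum_congr rfl
    intro b hb
    obtain ⟨d, hd, rfl⟩ := Finset.mem_image.1 hb
    have h1 : ∀ e ∈ D.filter (fun e => f e = f d), (1 : ℚ) / ((D.filter fun x => f x = f e).card : ℚ) = 1 / ((D.filter fun x => f x = f d).card : ℚ) := by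
      intro e he
      rw [(Finset.mem_filter.1 he).2]
    rw [Finset.sum_congr rfl h1, Finset.sum_const, nsmul_eq_mul]
    have : ((D.filter fun x => f x = f d).card : ℚ) ≠ 0 := by
      rw [Nat.cast_ne_zero]
      have hmem : d ∈ D.filter fun x => f x = f d := Finset.mem_filter.2 ⟨hd, rfl⟩
      exact (Finset.card_pos.2 ⟨d, hmem⟩).ne'
    field_simp
  rw [Finset.sum_sub_distrib, h]
  simp

open Classical

variable {F : Type*} [Field F] [Fintype F] {p : ℕ} [Fact p.Prime] [CharP F p]

noncomputable def PP (F : Type*) [Field F] [Fintype F] (p : ℕ) : Finset F[X] :=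
  Finset.univ.image fun c : Fin (p - 1) → F => X ^ p + X * ((degreeLTEquiv F (p - 1)).symm c : F[X])

theorem mem_PP (P : F[X]) : P ∈ PP F p ↔ MO p P := by
  have hp := (Fact.out : p.Prime)
  simp only [PP, Finset.mem_image, Finset.mem_univ, true_and]
  constructor
  · rintro ⟨c, rfl⟩
    have hQ := ((degreeLTEquiv F (p - 1)).symm c).2
    rw [mem_degreeLT] at hQ
    generalize (((degreeLTEquiv F (p - 1)).symm c : degreeLT F (p - 1)) : F[X]) = Q at hQ ⊢
    have hd : (X * Q).degree < (X ^ p : F[X]).degree := by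
      rw [degree_X_pow]
      by_cases h0 : Q = 0
      · simp [h0]
      · rw [degree_eq_natDegree h0] at hQ
        have h1 : Q.natDegree < p - 1 := by exact_mod_cast hQ
        rw [degree_mul, degree_X, degree_eq_natDegree h0]
        have : 1 + Q.natDegree < p := by omega
        exact_mod_cast this
    refine ⟨(monic_X_pow p).add_of_left hd, ?_, ?_⟩
    · rw [natDegree_add_eq_left_of_degree_lt hd, natDegree_X_pow]
    · simp [hp.ne_zero]
  · rintro ⟨hm, hd, ho⟩
    have h1 : (P - X ^ p).eval 0 = 0 := by simp [ho, hp.ne_zero]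
    have h2 : X ∣ P - X ^ p := by rw [X_dvd_iff, coeff_zero_eq_eval_zero, h1]
    obtain ⟨Q, hQ⟩ := h2
    have h3 : Q ∈ degreeLT F (p - 1) := by
      rw [mem_degreeLT]
      by_cases h0 : Q = 0
      · simp only [h0, degree_zero]; exact WithBot.bot_lt_coe _
      · have h4 : (P - X ^ p).degree < (p : WithBot ℕ) := by
          have hdp : P.degree = (p : WithBot ℕ) := by rw [degree_eq_natDegree hm.ne_zero, hd]
          rw [← hdp]
          apply degree_sub_lt
          · rw [hdp, degree_X_pow]
          · exact hm.ne_zero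
          · rw [hm.leadingCoeff, (monic_X_pow p).leadingCoeff]
        rw [hQ, degree_mul, degree_X, degree_eq_natDegree h0] at h4
        rw [degree_eq_natDegree h0]
        have h5 : 1 + Q.natDegree < p := by exact_mod_cast h4
        have : Q.natDegree < p - 1 := by omega
        exact_mod_cast this
    refine ⟨degreeLTEquiv F (p - 1) ⟨Q, h3⟩, ?_⟩
    rw [LinearEquiv.symm_apply_apply]
    rw [← hQ]; ring

theorem card_PP : (PP F p).card = Fintype.card F ^ (p - 1) := by
  rw [PP, Finset.card_image_of_injective, Finset.card_univ, Fintype.card_fun, Fintype.card_fin]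
  intro c d h
  have h1 := mul_left_cancel₀ X_ne_zero (add_left_cancel h)
  exact (degreeLTEquiv F (p - 1)).symm.injective (Subtype.ext h1)

theorem MO_X_pow : MO p (X ^ p : F[X]) :=
  ⟨monic_X_pow p, natDegree_X_pow p, by simp [(Fact.out : p.Prime).ne_zero]⟩

theorem MO.eq_X_pow {P : F[X]} (h : MO p P) (hd : derivative P = 0) : P = X ^ p := by
  have hp := (Fact.out : p.Prime)
  ext n
  rw [coeff_X_pow]
  rcases lt_trichotomy n p with hn | hn | hn
  · rw [if_neg hn.ne]
    rcases Nat.eq_zero_or_pos n with rfl | h0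
    · rw [coeff_zero_eq_eval_zero, h.o]
    · have h1 := congrArg (fun Q => Q.coeff (n - 1)) hd
      simp only [coeff_derivative, coeff_zero] at h1
      rw [Nat.sub_add_cancel h0] at h1
      rcases mul_eq_zero.1 h1 with h2 | h2
      · exact h2
      · exfalso
        have h3 : ((n : ℕ) : F) = 0 := by
          rw [← h2, ← Nat.cast_succ, Nat.succ_eq_add_one, Nat.sub_add_cancel h0]
        exact natCast_ne_zero_of_lt (p := p) n h0 hn h3
  · rw [if_pos hn, hn]
    have := h.m.coeff_natDegree
    rwa [h.d] at this
  · rw [if_neg hn.ne']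
    exact coeff_eq_zero_of_natDegree_lt (by rw [h.d]; exact hn)

theorem comp_cancel {g g' h : F[X]} (hh : 0 < h.natDegree) (e : g.comp h = g'.comp h) : g = g' := by
  have : (g - g').comp h = 0 := by rw [sub_comp, e, sub_self]
  rcases comp_eq_zero_iff.1 this with h1 | h1
  · exact sub_eq_zero.1 h1
  · rw [h1.2, natDegree_C] at hh; omega

noncomputable def Dec (F : Type*) [Field F] [Fintype F] (p : ℕ) : Finset (F[X] × F[X]) :=
  ((PP F p).erase (X ^ p)) ×ˢ ((PP F p).erase (X ^ p))

theorem mem_erase_PP (P : F[X]) : P ∈ (PP F p).erase (X ^ p) ↔ MO p P ∧ derivative P ≠ 0 := by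
  rw [Finset.mem_erase, mem_PP]
  constructor
  · rintro ⟨h1, h2⟩
    exact ⟨h2, fun h => h1 (h2.eq_X_pow h)⟩
  · rintro ⟨h1, h2⟩
    refine ⟨?_, h1⟩
    rintro rfl
    exact h2 derivative_X_pow_p

theorem mem_Dec (d : F[X] × F[X]) : d ∈ Dec F p ↔ (MO p d.1 ∧ derivative d.1 ≠ 0) ∧ (MO p d.2 ∧ derivative d.2 ≠ 0) := by
  rw [Dec, Finset.mem_product, mem_erase_PP, mem_erase_PP]

theorem card_Dec : ((Dec F p).card : ℚ) = ((Fintype.card F : ℚ) ^ (p - 1) - 1) ^ 2 := by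
  have h := Finset.card_erase_add_one ((mem_PP (p := p) (X ^ p : F[X])).2 MO_X_pow)
  rw [card_PP] at h
  have h1 : (((PP F p).erase (X ^ p)).card : ℚ) = (Fintype.card F : ℚ) ^ (p - 1) - 1 := by
    rw [eq_sub_iff_add_eq]; exact_mod_cast h
  rw [Dec, Finset.card_product]
  push_cast
  rw [h1]; ring

theorem sep_comp {g h : F[X]} (hg : MO p g) (hh : MO p h) (hg' : derivative g ≠ 0) (hh' : derivative h ≠ 0) :
    derivative (g.comp h) ≠ 0 := by
  rw [derivative_comp]
  refine mul_ne_zero hh' ?_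
  intro h0
  rcases comp_eq_zero_iff.1 h0 with h1 | h1
  · exact hg' h1
  · have := hh.d
    rw [h1.2, natDegree_C] at this
    exact (Fact.out : p.Prime).ne_zero this.symm

theorem Duniv_eq : Duniv F (p ^ 2) = (((PP F p ×ˢ PP F p).image fun d => d.1.comp d.2 : Finset F[X]) : Set F[X]) := by
  have hp := (Fact.out : p.Prime)
  ext f
  simp only [Duniv, Set.mem_setOf_eq, Finset.coe_image, Set.mem_image, Finset.mem_coe, Finset.mem_product, mem_PP]
  constructor
  · rintro ⟨hm, hd, ho, g, h, hg2, hh2, rfl⟩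
    rw [natDegree_comp] at hd
    have hdg : g.natDegree = p ∧ h.natDegree = p := by
      have h1 : g.natDegree ∣ p ^ 2 := ⟨_, hd.symm⟩
      obtain ⟨k, hk, e⟩ := (Nat.dvd_prime_pow hp).1 h1
      interval_cases k
      · rw [pow_zero] at e; omega
      · rw [pow_one] at e
        refine ⟨e, ?_⟩
        rw [e, sq] at hd
        exact Nat.eq_of_mul_eq_mul_left hp.pos hd
      · rw [e] at hd
        have : h.natDegree = 1 := Nat.eq_of_mul_eq_mul_left (pow_pos hp.pos 2) (by rw [hd, mul_one])
        omega
    have hh0 : h ≠ 0 := by rintro rfl; simp at hh2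
    have hl : h.leadingCoeff ≠ 0 := leadingCoeff_ne_zero.2 hh0
    set l := h.leadingCoeff with hldef
    set c := h.eval 0 with hc
    have e1 : (g.comp (C l * X + C c)).comp (C l⁻¹ * (h - C c)) = g.comp h := by
      rw [comp_assoc]
      congr 1
      simp only [add_comp, mul_comp, C_comp, X_comp]
      rw [← mul_assoc, ← C_mul, mul_inv_cancel₀ hl, C_1, one_mul, sub_add_cancel]
    have dh : (C l⁻¹ * (h - C c)).natDegree = p := by
      rw [natDegree_C_mul (inv_ne_zero hl), natDegree_sub_C, hdg.2]
    have mh : (C l⁻¹ * (h - C c)).Monic := by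
      rw [Monic, leadingCoeff_mul, leadingCoeff_C, leadingCoeff_sub_of_degree_lt, ← hldef, inv_mul_cancel₀ hl]
      refine lt_of_le_of_lt degree_C_le ?_
      rw [degree_eq_natDegree hh0, hdg.2]
      exact_mod_cast hp.pos
    have oh : (C l⁻¹ * (h - C c)).eval 0 = 0 := by simp [hc]
    refine ⟨(g.comp (C l * X + C c), C l⁻¹ * (h - C c)), ⟨⟨?_, ?_, ?_⟩, ⟨mh, dh, oh⟩⟩, e1⟩
    · have : (g.comp h).leadingCoeff = 1 := hm
      rw [← e1, leadingCoeff_comp (by rw [dh]; exact hp.ne_zero), mh.leadingCoeff, one_pow, mul_one] at this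
      exact this
    · rw [natDegree_comp, hdg.1, natDegree_linear hl, mul_one]
    · rw [← e1, eval_comp, oh] at ho
      exact ho
  · rintro ⟨⟨g, h⟩, ⟨hg, hh⟩, rfl⟩
    refine ⟨hg.m.comp hh.m (by rw [hh.d]; exact hp.ne_zero), ?_, ?_, g, h, ?_, ?_, rfl⟩
    · simp only [natDegree_comp, hg.d, hh.d]; ring
    · simp only [eval_comp, hh.o, hg.o]
    · rw [hg.d]; exact hp.two_le
    · rw [hh.d]; exact hp.two_le

theorem MO_map {P : F[X]} (h : MO p P) (σ : F →+* F) : MO p (P.map σ) :=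
  ⟨h.m.map σ, by rw [h.m.natDegree_map, h.d], by
    have := h.o
    rw [← coeff_zero_eq_eval_zero] at this ⊢
    rw [coeff_map, this, map_zero]⟩

theorem comp_X_pow_p {g : F[X]} (hg : MO p g) : ∃ h : F[X], MO p h ∧ g.comp (X ^ p) = h ^ p := by
  have hp := (Fact.out : p.Prime)
  have : PerfectRing F p := PerfectRing.ofFiniteOfIsReduced p F
  refine ⟨g.map ((frobeniusEquiv F p).symm : F →+* F), MO_map hg _, ?_⟩
  rw [← map_frobenius_expand (p := p) (f := g.map _), ← expand_eq_comp_X_pow, map_expand, map_map]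
  congr 1
  conv_lhs => rw [← g.map_id]
  congr 1
  ext x
  simp

theorem split_image : ((PP F p ×ˢ PP F p).image fun d => d.1.comp d.2) =
    ((PP F p).image fun h => h ^ p) ∪ (Dec F p).image fun d => d.1.comp d.2 := by
  ext f
  simp only [Finset.mem_union, Finset.mem_image, Finset.mem_product, mem_PP, mem_Dec]
  constructor
  · rintro ⟨⟨g, h⟩, ⟨hg, hh⟩, rfl⟩
    by_cases h1 : derivative g = 0
    · left
      refine ⟨h, hh, ?_⟩
      have : g = X ^ p := hg.eq_X_pow h1
      change h ^ p = g.comp h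
      rw [this, X_pow_comp]
    · by_cases h2 : derivative h = 0
      · left
        obtain ⟨k, hk, e⟩ := comp_X_pow_p hg
        refine ⟨k, hk, ?_⟩
        have : h = X ^ p := hh.eq_X_pow h2
        change k ^ p = g.comp h
        rw [this]
        exact e.symm
      · right
        exact ⟨(g, h), ⟨⟨hg, h1⟩, hh, h2⟩, rfl⟩
  · rintro (⟨h, hh, rfl⟩ | ⟨d, hd, rfl⟩)
    · exact ⟨(X ^ p, h), ⟨MO_X_pow, hh⟩, X_pow_comp⟩
    · exact ⟨d, ⟨hd.1.1, hd.2.1⟩, rfl⟩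

theorem ncard_Duniv : (Set.ncard (Duniv F (p ^ 2)) : ℚ) =
    (Fintype.card F : ℚ) ^ (p - 1) + ((Fintype.card F : ℚ) ^ (p - 1) - 1) ^ 2 -
     ∑ d ∈ Dec F p, ((1 : ℚ) - 1 / (((Dec F p).filter fun e => e.1.comp e.2 = d.1.comp d.2).card : ℚ)) := by
  have hp := (Fact.out : p.Prime)
  rw [Duniv_eq, Set.ncard_coe_finset, split_image, Finset.card_union_of_disjoint, Finset.card_image_of_injOn, card_PP]
  · push_cast
    rw [card_image_fib, card_Dec]
    ring
  · intro a ha b hb e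
    rw [Finset.mem_coe, mem_PP] at ha hb
    exact monic_pow_inj ha.m hb.m hp.ne_zero e
  · rw [Finset.disjoint_left]
    intro f hf hf'
    obtain ⟨h, hh, rfl⟩ := Finset.mem_image.1 hf
    obtain ⟨d, hd, e⟩ := Finset.mem_image.1 hf'
    rw [mem_Dec] at hd
    have := sep_comp hd.1.1 hd.2.1 hd.1.2 hd.2.2
    rw [e] at this
    apply this
    rw [derivative_pow, CharP.cast_eq_zero]
    simp

theorem fibre_class {d e : F[X] × F[X]} (hd : d ∈ Dec F p) (he : e ∈ Dec F p) (h : e.1.comp e.2 = d.1.comp d.2)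
    (hne : e ≠ d) : IsS p d.1 d.2 e.1 e.2 ∨ IsM p d.1 d.2 e.1 e.2 := by
  rw [mem_Dec] at hd he
  have hp := (Fact.out : p.Prime)
  apply Coll.classF
  refine ⟨hd.1.1.m, hd.2.1.m, he.1.1.m, he.2.1.m, hd.1.1.d, hd.2.1.d, he.1.1.d, he.2.1.d,
    hd.1.1.o, hd.2.1.o, he.1.1.o, he.2.1.o, h.symm, ?_, sep_comp hd.1.1 hd.2.1 hd.1.2 hd.2.2⟩
  intro h2
  apply hne
  refine Prod.ext ?_ h2.symm
  rw [← h2] at h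
  exact comp_cancel (by rw [hd.2.1.d]; exact hp.pos) h

end


open Polynomial

set_option linter.unusedSectionVars false
set_option linter.unusedSimpArgs false
set_option linter.deprecated false
set_option linter.unusedVariables false

section
open Classical

variable {F : Type*} [Field F] [Fintype F] {p : ℕ} [Fact p.Prime] [CharP F p]

noncomputable def idxS (F : Type*) [Field F] [Fintype F] (p : ℕ) : Finset (ℕ × F) :=
  ((p - 1).divisors ×ˢ Finset.univ).filter fun i => i.1 = 1 → i.2 = 0

theorem mem_idxS (i : ℕ × F) : i ∈ idxS F p ↔ i.1 ∣ p - 1 ∧ (i.1 = 1 → i.2 = 0) := by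
  have hp := (Fact.out : p.Prime).two_le
  simp only [idxS, Finset.mem_filter, Finset.mem_product, Nat.mem_divisors, Finset.mem_univ, and_true]
  constructor
  · rintro ⟨⟨a, b⟩, c⟩; exact ⟨a, c⟩
  · rintro ⟨a, c⟩; exact ⟨⟨a, by omega⟩, c⟩

theorem card_idxS : ((idxS F p).card : ℚ) = ((p - 1).divisors.card : ℚ) * Fintype.card F - Fintype.card F + 1 := by
  have hp := (Fact.out : p.Prime).two_le
  have h1 : 1 ∈ (p - 1).divisors := by rw [Nat.mem_divisors]; exact ⟨one_dvd _, by omega⟩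
  have h : idxS F p = insert (1, 0) (((p - 1).divisors.erase 1) ×ˢ Finset.univ) := by
    ext ⟨m, w⟩
    simp only [idxS, Finset.mem_filter, Finset.mem_product, Finset.mem_univ, and_true, Finset.mem_insert,
      Finset.mem_erase, Prod.mk.injEq]
    by_cases hm : m = 1
    · subst hm; simp only [h1]; tauto
    · tauto
  rw [h, Finset.card_insert_of_notMem (by simp), Finset.card_product, Finset.card_univ]
  have := Finset.card_erase_add_one h1
  rw [← this]
  push_cast
  ring

noncomputable def dS (p : ℕ) (t : (ℕ × F) × (F × F)) : F[X] × F[X] :=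
  (gS p t.1.1 t.1.2 t.2.1 t.2.2, hS p t.1.1 t.1.2 t.2.2)

noncomputable def TS (F : Type*) [Field F] [Fintype F] (p : ℕ) : Finset ((ℕ × F) × (F × F)) :=
  idxS F p ×ˢ (Nz F ×ˢ Nz F)

theorem mem_TS (t : (ℕ × F) × (F × F)) : t ∈ TS F p ↔
    (t.1.1 ∣ p - 1 ∧ (t.1.1 = 1 → t.1.2 = 0)) ∧ t.2.1 ≠ 0 ∧ t.2.2 ≠ 0 := by
  rw [TS, Finset.mem_product, mem_idxS, Finset.mem_product]
  simp [Nz]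

theorem dS_mem {t : (ℕ × F) × (F × F)} (ht : t ∈ TS F p) : dS p t ∈ Dec F p := by
  rw [mem_TS] at ht
  obtain ⟨⟨hm, hw⟩, hα, hβ⟩ := ht
  rw [mem_Dec]
  refine ⟨⟨MO_gS hm _ _ _, ?_⟩, ⟨MO_hS hm _ _, ?_⟩⟩
  · simp only [dS]
    rw [derivative_gS _ hm, ← leadingCoeff_ne_zero, lc_S _ hm]
    exact neg_ne_zero.2 hα
  · simp only [dS]
    rw [derivative_hS _ hm, ← leadingCoeff_ne_zero, lc_S _ hm]
    exact neg_ne_zero.2 hβ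

theorem dS_inj : Set.InjOn (dS (F := F) p) (TS F p) := by
  rintro ⟨⟨m, w⟩, α, β⟩ h1 ⟨⟨m', w'⟩, α', β'⟩ h2 e
  rw [Finset.mem_coe, mem_TS] at h1 h2
  obtain ⟨⟨hm, hw⟩, hα, hβ⟩ := h1
  obtain ⟨⟨hm', hw'⟩, hα', hβ'⟩ := h2
  simp only [dS, Prod.mk.injEq] at *
  obtain ⟨rfl, rfl, rfl⟩ := hS_inj hm hm' hβ hβ' hw hw' e.2
  have := gS_inj hm e.1
  simp [this]

theorem fib_S {t : (ℕ × F) × (F × F)} (ht : t ∈ TS F p) :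
    ((Dec F p).filter fun e => e.1.comp e.2 = (dS p t).1.comp (dS p t).2).card = (Rset p t.2.1 t.2.2).card := by
  have hd := dS_mem ht
  have ht0 := ht
  obtain ⟨⟨m, w⟩, α, β⟩ := t
  rw [mem_TS] at ht
  obtain ⟨⟨hm, hw⟩, hα, hβ⟩ := ht
  simp only at hm hw hα hβ
  have hR : ∀ x ∈ Rset p α β, (((m, w), x) : (ℕ × F) × (F × F)) ∈ TS F p := by
    intro x hx
    simp only [Rset, Finset.mem_filter] at hx
    rw [mem_TS]
    exact ⟨⟨hm, hw⟩, hx.2.1, hx.2.2.1⟩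
  have : ((Dec F p).filter fun e => e.1.comp e.2 = (dS p ((m, w), (α, β))).1.comp (dS p ((m, w), (α, β))).2) =
      (Rset p α β).image fun x => dS p ((m, w), x) := by
    ext e
    rw [Finset.mem_filter, Finset.mem_image]
    constructor
    · rintro ⟨he, h⟩
      by_cases hne : e = dS p ((m, w), (α, β))
      · exact ⟨(α, β), by simp [Rset, hα, hβ], hne.symm⟩
      · rcases fibre_class hd he h hne with hS | hM
        · obtain ⟨m', w', a, b, a', b', hm', hw', ha, hb, ha', hb', e1, e2, e3, e4⟩ := hS
          simp only [dS] at e1 e2 h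
          obtain ⟨rfl, rfl, rfl⟩ := hS_inj hm hm' hβ hb hw hw' e1
          have e5 := gS_inj hm e2
          subst e5
          rw [e3, e4, comp_S_eq hm] at h
          refine ⟨(a', b'), ?_, ?_⟩
          · simp only [Rset, Finset.mem_filter, Finset.mem_univ, true_and]
            exact ⟨ha', hb', h⟩
          · exact Prod.ext e4.symm e3.symm
        · obtain ⟨m', w', b, a, hm1, hm2, hb, ha, hab, e1, -⟩ := hM
          exact absurd e1 (hS_ne_hM hm hm1 hm2 hβ hb hab)
    · rintro ⟨x, hx, rfl⟩
      refine ⟨dS_mem (hR x hx), ?_⟩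
      simp only [Rset, Finset.mem_filter, Finset.mem_univ, true_and] at hx
      simp only [dS]
      rw [comp_S_eq hm]
      exact hx.2.2
  rw [this, Finset.card_image_of_injOn]
  intro x hx y hy e
  have := dS_inj (hR x hx) (hR y hy) e
  simpa using this

noncomputable def TM (F : Type*) [Field F] [Fintype F] (p : ℕ) : Finset ((ℕ × F) × (F × F)) :=
  (Finset.Ico (p / 2 + 1) (p - 1) ×ˢ Finset.univ) ×ˢ ((Nz F ×ˢ Nz F).filter fun x => x.2 ≠ x.1 ^ p)

theorem mem_TM (t : (ℕ × F) × (F × F)) : t ∈ TM F p ↔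
    (p < 2 * t.1.1 ∧ t.1.1 + 2 ≤ p) ∧ t.2.1 ≠ 0 ∧ t.2.2 ≠ 0 ∧ t.2.2 ≠ t.2.1 ^ p := by
  have hp := (Fact.out : p.Prime).two_le
  have : (p / 2 + 1 ≤ t.1.1 ∧ t.1.1 < p - 1) ↔ (p < 2 * t.1.1 ∧ t.1.1 + 2 ≤ p) := by omega
  rw [← this]
  simp [TM, Nz, and_assoc]

theorem card_TM : ((TM F p).card : ℚ) / 2 =
    (1 - if p = 2 then 1 else 0) * (Fintype.card F : ℚ) * (Fintype.card F - 1) * (Fintype.card F - 2) * (p - 3) / 4 := by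
  have hp := (Fact.out : p.Prime)
  have h1 : ((((Nz F ×ˢ Nz F).filter fun x => x.2 ≠ x.1 ^ p).card : ℕ) : ℚ) = ((Fintype.card F : ℚ) - 1) * (Fintype.card F - 2) := by
    have h2 := Finset.card_filter_add_card_filter_not (s := Nz F ×ˢ Nz F) (fun x => x.2 = x.1 ^ p)
    have h3 : ((Nz F ×ˢ Nz F).filter fun x => x.2 = x.1 ^ p).card = (Nz F).card := by
      refine Finset.card_bij' (fun x _ => x.1) (fun b _ => (b, b ^ p)) ?_ ?_ ?_ ?_
      · rintro ⟨b, a⟩ h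
        simp only [Finset.mem_filter, Finset.mem_product] at h
        exact h.1.1
      · intro b hb
        simp only [Nz, Finset.mem_filter, Finset.mem_product, Finset.mem_erase, Finset.mem_univ, and_true] at hb ⊢
        exact ⟨hb, pow_ne_zero _ hb⟩
      · rintro ⟨b, a⟩ h
        simp only [Finset.mem_filter, Finset.mem_product] at h
        exact Prod.ext rfl h.2.symm
      · intro b hb; rfl
    rw [h3, Finset.card_product] at h2
    have h4 := card_Nz (F := F)
    have h5 : ((Nz F).card : ℚ) + ((((Nz F ×ˢ Nz F).filter fun x => x.2 ≠ x.1 ^ p).card : ℕ) : ℚ) = (Nz F).card * (Nz F).card := by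
      exact_mod_cast h2
    rw [h4] at h5
    linear_combination h5
  rw [TM, Finset.card_product, Finset.card_product, Finset.card_univ, Nat.card_Ico]
  push_cast
  rw [h1]
  rcases hp.eq_two_or_odd' with h | ⟨k, hk⟩
  · rw [if_pos h, h]; norm_num
  · have hk1 : 1 ≤ k := by have := hp.two_le; omega
    have : p - 1 - (p / 2 + 1) = k - 1 := by omega
    rw [if_neg (by omega), this, Nat.cast_sub hk1, hk]
    push_cast
    ring

noncomputable def dM (p : ℕ) (t : (ℕ × F) × (F × F)) : F[X] × F[X] :=
  (gM p t.1.1 t.1.2 t.2.1 t.2.2, hM p t.1.1 t.1.2 t.2.1 t.2.2)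

theorem derivative_gM_ne {m : ℕ} (hm : p < 2 * m) (hm2 : m + 2 ≤ p) (w b a : F) (ha : a ≠ 0) :
    derivative (gM p m w b a) ≠ 0 := by
  rw [gM, derivative_orig]
  generalize eval w (hM p m w b a) = c
  obtain ⟨r, hr⟩ : ∃ r, p - m = r + 1 := ⟨p - m - 1, by omega⟩
  obtain ⟨k, rfl⟩ : ∃ k, m = k + 1 := ⟨m - 1, by omega⟩
  have hpk : ((k + 1 : ℕ) : F[X]) + ((r + 1 : ℕ) : F[X]) = 0 := by
    rw [← Nat.cast_add, show k + 1 + (r + 1) = p by omega, CharP.cast_eq_zero]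
  have hk : ((k + 1 : ℕ) : F) ≠ 0 := natCast_ne_zero_of_lt (p := p) _ (by omega) (by omega)
  have : derivative ((X - C c) ^ (k + 1) * (X - C (c + a)) ^ (p - (k + 1))) =
      C (-(((k + 1 : ℕ) : F) * a)) * ((X - C c) ^ k * (X - C (c + a)) ^ r) := by
    rw [hr, derivative_mul, derivative_pow, derivative_pow]
    simp only [derivative_sub, derivative_add, derivative_X, derivative_C, add_zero, sub_zero, mul_one, Nat.add_sub_cancel, map_natCast,
      C_neg, C_mul, C_add]
    linear_combination (X - C c) ^ (k + 1) * (X - (C c + C a)) ^ r * hpk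
  rw [this]
  exact mul_ne_zero (C_ne_zero.2 (neg_ne_zero.2 (mul_ne_zero hk ha)))
    (mul_ne_zero (pow_ne_zero _ (X_sub_C_ne_zero _)) (pow_ne_zero _ (X_sub_C_ne_zero _)))

theorem dM_mem {t : (ℕ × F) × (F × F)} (ht : t ∈ TM F p) : dM p t ∈ Dec F p := by
  rw [mem_TM] at ht
  obtain ⟨⟨hm, hm2⟩, hb, ha, hab⟩ := ht
  rw [mem_Dec]
  refine ⟨⟨MO_gM hm2 _ _ _, derivative_gM_ne hm hm2 _ _ _ ha⟩, ⟨MO_hM hm2 _ _ _ hb, ?_⟩⟩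
  simp only [dM]
  rw [derivative_hM _ hm hm2]
  exact mul_ne_zero (mul_ne_zero (C_ne_zero.2 (kM_ne hm hm2 hb hab)) (pow_ne_zero _ (X_sub_C_ne_zero _)))
    (pow_ne_zero _ (X_sub_C_ne_zero _))

theorem dM_inj : Set.InjOn (dM (F := F) p) (TM F p) := by
  rintro ⟨⟨m, w⟩, b, a⟩ h1 ⟨⟨m', w'⟩, b', a'⟩ h2 e
  rw [Finset.mem_coe, mem_TM] at h1 h2
  obtain ⟨⟨hm, hm2⟩, hb, ha, hab⟩ := h1
  obtain ⟨⟨hm', hm2'⟩, hb', ha', hab'⟩ := h2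
  simp only [dM, Prod.mk.injEq] at *
  obtain ⟨rfl, rfl, rfl, rfl⟩ := hM_inj hm hm2 hm' hm2' hb hb' hab hab' e.2
  simp

theorem fib_M {t : (ℕ × F) × (F × F)} (ht : t ∈ TM F p) :
    ((Dec F p).filter fun e => e.1.comp e.2 = (dM p t).1.comp (dM p t).2).card = 2 := by
  have hd := dM_mem ht
  have ht0 := ht
  obtain ⟨⟨m, w⟩, b, a⟩ := t
  rw [mem_TM] at ht
  obtain ⟨⟨hm, hm2⟩, hb, ha, hab⟩ := ht
  simp only at hm hm2 hb ha hab
  have hσ : (((m, w + b), (-b, a - b ^ p)) : (ℕ × F) × (F × F)) ∈ TM F p := by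
    rw [mem_TM]
    refine ⟨⟨hm, hm2⟩, neg_ne_zero.2 hb, sub_ne_zero.2 hab, ?_⟩
    simp only
    rw [neg_pow_p]
    intro h
    apply ha
    linear_combination h
  rw [Finset.card_eq_two]
  refine ⟨dM p ((m, w), (b, a)), dM p ((m, w + b), (-b, a - b ^ p)), ?_, ?_⟩
  · intro h
    have := dM_inj ht0 hσ h
    simp only [Prod.mk.injEq, true_and, left_eq_add] at this
    exact hb this.1
  · ext e
    rw [Finset.mem_filter, Finset.mem_insert, Finset.mem_singleton]
    constructor
    · rintro ⟨he, h⟩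
      by_cases hne : e = dM p ((m, w), (b, a))
      · exact Or.inl hne
      · right
        rcases fibre_class hd he h hne with hS | hM
        · obtain ⟨m', w', α, β, α', β', hm', hw', hα, hβ, hα', hβ', e1, -⟩ := hS
          exact absurd e1.symm (hS_ne_hM hm' hm hm2 hβ hb hab)
        · obtain ⟨m', w', b', a', hm1, hm2', hb', ha', hab', e1, e2, e3, e4⟩ := hM
          simp only [dM] at e1
          obtain ⟨rfl, rfl, rfl, rfl⟩ := hM_inj hm hm2 hm1 hm2' hb hb' hab hab' e1
          exact Prod.ext e4 e3
    · rintro (rfl | rfl)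
      · exact ⟨hd, rfl⟩
      · exact ⟨dM_mem hσ, comp_M hm hm2 w b a hb⟩

theorem sum_Dec : ∑ d ∈ Dec F p, ((1 : ℚ) - 1 / (((Dec F p).filter fun e => e.1.comp e.2 = d.1.comp d.2).card : ℚ)) =
    (((p - 1).divisors.card : ℚ) * Fintype.card F - Fintype.card F + 1) *
      (((Fintype.card F : ℚ) - 1) * (Fintype.card F * p - p - 2) / (2 * (p + 1))) + ((TM F p).card : ℚ) / 2 := by
  have hsub : (TS F p).image (dS p) ∪ (TM F p).image (dM p) ⊆ Dec F p := by
    intro d hd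
    rcases Finset.mem_union.1 hd with h | h
    · obtain ⟨t, ht, rfl⟩ := Finset.mem_image.1 h
      exact dS_mem ht
    · obtain ⟨t, ht, rfl⟩ := Finset.mem_image.1 h
      exact dM_mem ht
  rw [← Finset.sum_subset hsub, Finset.sum_union, Finset.sum_image dS_inj, Finset.sum_image dM_inj]
  · congr 1
    · have : ∀ t ∈ TS F p, ((1 : ℚ) - 1 / (((Dec F p).filter fun e => e.1.comp e.2 = (dS p t).1.comp (dS p t).2).card : ℚ)) =
          (1 : ℚ) - 1 / ((Rset p t.2.1 t.2.2).card : ℚ) := by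
        intro t ht
        rw [fib_S ht]
      rw [Finset.sum_congr rfl this, TS, Finset.sum_product]
      simp only
      rw [sum_R, Finset.sum_const, nsmul_eq_mul, card_idxS]
    · have : ∀ t ∈ TM F p, ((1 : ℚ) - 1 / (((Dec F p).filter fun e => e.1.comp e.2 = (dM p t).1.comp (dM p t).2).card : ℚ)) =
          1 / 2 := by
        intro t ht
        rw [fib_M ht]; norm_num
      rw [Finset.sum_congr rfl this, Finset.sum_const, nsmul_eq_mul]
      ring
  · rw [Finset.disjoint_left]
    intro d h1 h2
    obtain ⟨t, ht, rfl⟩ := Finset.mem_image.1 h1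
    obtain ⟨s, hs, e⟩ := Finset.mem_image.1 h2
    rw [mem_TS] at ht
    rw [mem_TM] at hs
    exact hS_ne_hM ht.1.1 hs.1.1 hs.1.2 ht.2.2 hs.2.1 hs.2.2.2 (congrArg Prod.snd e).symm
  · intro d hd hn
    have : ((Dec F p).filter fun e => e.1.comp e.2 = d.1.comp d.2) = {d} := by
      ext e
      rw [Finset.mem_filter, Finset.mem_singleton]
      constructor
      · rintro ⟨he, h⟩
        by_contra hne
        apply hn
        rw [Finset.mem_union]
        rcases fibre_class hd he h hne with hS | hM
        · left
          obtain ⟨m, w, α, β, α', β', hm, hw, hα, hβ, hα', hβ', e1, e2, -⟩ := hS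
          refine Finset.mem_image.2 ⟨((m, w), (α, β)), ?_, Prod.ext e2.symm e1.symm⟩
          rw [mem_TS]; exact ⟨⟨hm, hw⟩, hα, hβ⟩
        · right
          obtain ⟨m, w, b, a, hm1, hm2, hb, ha, hab, e1, e2, -⟩ := hM
          refine Finset.mem_image.2 ⟨((m, w), (b, a)), ?_, Prod.ext e2.symm e1.symm⟩
          rw [mem_TM]; exact ⟨⟨hm1, hm2⟩, hb, ha, hab⟩
      · rintro rfl; exact ⟨hd, rfl⟩
    rw [this]; simp

end

theorem stmt19 (q : ℕ) (F : Type) [Field F] [Fintype F] (hq : Fintype.card F = q)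
    (p : ℕ) (hp : ringChar F = p)
    (τ : ℕ) (hτ : τ = (p - 1).divisors.card) :
    (Set.ncard (Duniv F (p ^ 2)) : ℚ) =
      (q : ℚ) ^ (2 * p - 2) - (q : ℚ) ^ (p - 1) + 1 -
        ((τ : ℚ) * q - q + 1) * (q - 1) * (q * p - p - 2) / (2 * (p + 1)) -
        (1 - if p = 2 then 1 else 0) * q * (q - 1) * (q - 2) * (p - 3) / 4 := by
  have hc : CharP F p := by rw [← hp]; exact ringChar.charP F
  have hpr : p.Prime := CharP.char_is_prime F p
  have : Fact p.Prime := ⟨hpr⟩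
  rw [ncard_Duniv, sum_Dec, card_TM, hq, ← hτ, show 2 * p - 2 = (p - 1) * 2 by omega, pow_mul]
  ring
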